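/- arXiv:2410.17231 — 9 statements merged into one kernel-verified Lean document; each statement's English description precedes it below -/
import Mathlib

section
/- For every x₁ ∈ ℝ and every x₂ > 0, the function t ↦ e^{2π t x₁} · K₀(2π t √(x₁² + x₂)) is integrable on the interval [1, ∞). -/
open MeasureTheory

/-- The modified Bessel function of the second kind of order zero,
`K₀(y) = ∫₀^∞ e^{−y cosh s} ds`. -/
noncomputable def K0 (y : ℝ) : ℝ := ∫ s in Set.Ioi (0 : ℝ), Real.exp (-y * Real.cosh s)

theorem one_add_sq_div_two_le_cosh (x : ℝ) : 1 + x ^ 2 / 2 ≤ Real.cosh x := by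
  have habs : |x / 2| ≤ |Real.sinh (x / 2)| := by
    rw [Real.abs_sinh]
    exact Real.self_le_sinh_iff.mpr (abs_nonneg _)
  have hsq := sq_le_sq.mpr habs
  have hdouble := Real.cosh_two_mul (x / 2)
  rw [mul_div_cancel₀ x two_ne_zero, Real.cosh_sq] at hdouble
  nlinarith

theorem stronglyMeasurable_K0 : StronglyMeasurable K0 := by
  have h : Continuous fun p : ℝ × ℝ => Real.exp (-p.1 * Real.cosh p.2) := by fun_prop
  exact h.stronglyMeasurable.integral_prod_right'

theorem K0_nonneg (y : ℝ) : 0 ≤ K0 y :=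
  integral_nonneg fun _ => (Real.exp_pos _).le

/-- On `[c, ∞)` with `c > 0`, the function `K0` is bounded by a constant multiple of `e^{-y}`. -/
theorem K0_le_exp_neg_mul_integral {c y : ℝ} (hc : 0 < c) (hy : c ≤ y) :
    K0 y ≤ Real.exp (-y) * ∫ s in Set.Ioi (0 : ℝ), Real.exp (-(c / 2) * s ^ 2) := by
  rw [← integral_const_mul]
  refine integral_mono_of_nonneg (.of_forall fun _ => (Real.exp_pos _).le)
    ((integrable_exp_neg_mul_sq (half_pos hc)).integrableOn.const_mul _)
    (.of_forall fun s => ?_)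
  simp only [← Real.exp_add]
  refine Real.exp_le_exp.mpr ?_
  have hcosh : 1 + s ^ 2 / 2 ≤ Real.cosh s := one_add_sq_div_two_le_cosh s
  nlinarith [mul_le_mul_of_nonneg_left hcosh (hc.le.trans hy),
    mul_le_mul_of_nonneg_right hy (sq_nonneg s)]

/-- For `x₁ ∈ ℝ` and `x₂ > 0`, the function `t ↦ e^{2πtx₁} K₀(2πt√(x₁²+x₂))` is
integrable on `[1, ∞)`. -/
theorem stmt4 (x₁ x₂ : ℝ) (hx₂ : 0 < x₂) :
    IntegrableOn
      (fun t : ℝ => Real.exp (2 * Real.pi * t * x₁) *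
        K0 (2 * Real.pi * t * Real.sqrt (x₁ ^ 2 + x₂)))
      (Set.Ici (1 : ℝ)) := by
  set r := Real.sqrt (x₁ ^ 2 + x₂)
  have hr : 0 < r := Real.sqrt_pos.mpr (by positivity)
  have hxr : x₁ < r := Real.lt_sqrt_of_sq_lt (by linarith)
  have hc : 0 < 2 * Real.pi * r := by positivity
  have hb : 0 < 2 * Real.pi * (r - x₁) := mul_pos (by positivity) (sub_pos.mpr hxr)
  have hbound := ((integrableOn_Ici_iff_integrableOn_Ioi).mpr
    (exp_neg_integrableOn_Ioi 1 hb)).mul_const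
      (∫ s in Set.Ioi (0 : ℝ), Real.exp (-(2 * Real.pi * r / 2) * s ^ 2))
  refine Integrable.mono' hbound ?_ ?_
  · exact ((by fun_prop : Measurable fun t : ℝ => Real.exp (2 * Real.pi * t * x₁)).mul
      (stronglyMeasurable_K0.measurable.comp (by fun_prop))).aestronglyMeasurable
  · filter_upwards [ae_restrict_mem measurableSet_Ici] with t ht
    rw [Real.norm_of_nonneg (mul_nonneg (Real.exp_pos _).le (K0_nonneg _))]
    have hle : 2 * Real.pi * r ≤ 2 * Real.pi * t * r := by
      nlinarith [mul_le_mul_of_nonneg_left (Set.mem_Ici.mp ht) hc.le]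
    calc _ ≤ Real.exp (2 * Real.pi * t * x₁) * (Real.exp (-(2 * Real.pi * t * r)) * _) :=
          mul_le_mul_of_nonneg_left (K0_le_exp_neg_mul_integral hc hle) (Real.exp_pos _).le
      _ = _ := by
          rw [← mul_assoc, ← Real.exp_add]
          ring_nf
end

section
/- There exists a constant C > 0 such that for all x₁ ∈ ℝ and x₂ > 0, the quantity W*(x₁,x₂) := (1/2)·√x₂ · ∫₁^∞ e^{2π t x₁} · K₀(2π t √(x₁² + x₂)) dt satisfies W*(x₁, x₂) ≤ C · exp(−2π(√(x₁² + x₂) − x₁)). -/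
open MeasureTheory

/-- `W*(x₁,x₂) = (1/2)√x₂ ∫₁^∞ e^{2πtx₁} K₀(2πt√(x₁²+x₂)) dt`. -/
noncomputable def Wstar (x₁ x₂ : ℝ) : ℝ :=
  (1 / 2) * Real.sqrt x₂ *
    ∫ t in Set.Ici (1 : ℝ), Real.exp (2 * Real.pi * t * x₁) *
      K0 (2 * Real.pi * t * Real.sqrt (x₁ ^ 2 + x₂))

theorem one_add_sq_half_le_cosh {s : ℝ} (hs : 0 ≤ s) : 1 + s ^ 2 / 2 ≤ Real.cosh s := by
  have h : s / 2 ≤ Real.sinh (s / 2) := Real.self_le_sinh_iff.2 (by positivity)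
  have h2 : Real.cosh s = 1 + 2 * Real.sinh (s / 2) ^ 2 := by
    have := Real.cosh_two_mul (s / 2)
    rw [Real.cosh_sq, mul_div_cancel₀ s two_ne_zero] at this
    linarith
  nlinarith

theorem K0_le {y : ℝ} (hy : 0 < y) :
    K0 y ≤ Real.exp (-y) * (Real.sqrt (Real.pi / (y / 2)) / 2) := by
  rw [← integral_gaussian_Ioi, ← integral_const_mul]
  refine integral_mono_of_nonneg (.of_forall fun _ => (Real.exp_pos _).le)
    ((integrable_exp_neg_mul_sq (half_pos hy)).integrableOn.const_mul _) ?_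
  filter_upwards [ae_restrict_mem measurableSet_Ioi] with s hs
  rw [← Real.exp_add, Real.exp_le_exp]
  nlinarith [one_add_sq_half_le_cosh (le_of_lt hs)]

theorem integral_exp_mul_K0_le {a r : ℝ} (hr : 0 < r) (har : a < r) :
    ∫ t in Set.Ici (1 : ℝ), Real.exp (2 * Real.pi * t * a) * K0 (2 * Real.pi * t * r) ≤
      Real.exp (-(2 * Real.pi) * (r - a)) / (2 * Real.sqrt r * Real.sqrt (2 * (r - a))) := by
  have hd : 0 < r - a := sub_pos.2 har
  have hpi := Real.pi_pos
  have hc : 0 < 2 * Real.pi * (r - a) := by positivity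
  have key := Real.integral_rpow_mul_exp_neg_mul_Ioi (a := 1 / 2) (by norm_num) hc
  have hint : IntegrableOn (fun t : ℝ => t ^ ((1 / 2 : ℝ) - 1) *
      Real.exp (-(2 * Real.pi * (r - a) * t))) (Set.Ioi 0) :=
    .of_integral_ne_zero (by rw [key, Real.Gamma_one_half_eq]; positivity)
  have heq : Real.exp (-(2 * Real.pi) * (r - a)) / (2 * Real.sqrt r * Real.sqrt (2 * (r - a))) =
      ∫ u in Set.Ioi (0 : ℝ), Real.exp (-(2 * Real.pi) * (r - a)) / (2 * Real.sqrt r) *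
        (u ^ ((1 / 2 : ℝ) - 1) * Real.exp (-(2 * Real.pi * (r - a) * u))) := by
    rw [integral_const_mul, key, Real.Gamma_one_half_eq, ← Real.sqrt_eq_rpow,
      ← Real.sqrt_mul (by positivity),
      show 1 / (2 * Real.pi * (r - a)) * Real.pi = (2 * (r - a))⁻¹ by field_simp,
      Real.sqrt_inv]
    field_simp
  rw [integral_Ici_eq_integral_Ioi, heq,
    ← (measurePreserving_add_right volume (1 : ℝ)).setIntegral_preimage_emb
      (measurableEmbedding_addRight 1), Set.preimage_add_const_Ioi, sub_self]
  refine integral_mono_of_nonneg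
    (.of_forall fun _ => mul_nonneg (Real.exp_pos _).le (K0_nonneg _)) (hint.const_mul _) ?_
  filter_upwards [ae_restrict_mem measurableSet_Ioi] with u hu
  have hu : 0 < u := hu
  have hsqrt : Real.sqrt (Real.pi / (2 * Real.pi * (u + 1) * r / 2)) ≤
      (Real.sqrt u)⁻¹ * (Real.sqrt r)⁻¹ := by
    rw [← Real.sqrt_inv, ← Real.sqrt_inv, ← Real.sqrt_mul (by positivity),
      show Real.pi / (2 * Real.pi * (u + 1) * r / 2) = (u + 1)⁻¹ * r⁻¹ by field_simp]
    gcongr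
    linarith
  calc Real.exp (2 * Real.pi * (u + 1) * a) * K0 (2 * Real.pi * (u + 1) * r)
      ≤ Real.exp (2 * Real.pi * (u + 1) * a) * (Real.exp (-(2 * Real.pi * (u + 1) * r)) *
        ((Real.sqrt u)⁻¹ * (Real.sqrt r)⁻¹ / 2)) := by
        gcongr
        refine (K0_le (by positivity)).trans ?_
        gcongr
    _ = (Real.exp (2 * Real.pi * (u + 1) * a) * Real.exp (-(2 * Real.pi * (u + 1) * r))) *
        ((Real.sqrt u)⁻¹ * (Real.sqrt r)⁻¹ / 2) := by ring
    _ = (Real.exp (-(2 * Real.pi) * (r - a)) * Real.exp (-(2 * Real.pi * (r - a) * u))) *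
        ((Real.sqrt u)⁻¹ * (Real.sqrt r)⁻¹ / 2) := by
        rw [← Real.exp_add, ← Real.exp_add]
        ring_nf
    _ = _ := by
        rw [show (1 / 2 : ℝ) - 1 = -(1 / 2) by norm_num, Real.rpow_neg hu.le,
          ← Real.sqrt_eq_rpow]
        field_simp

/-- There is `C > 0` with `W*(x₁,x₂) ≤ C exp(−2π(√(x₁²+x₂) − x₁))` for all `x₁` and
all `x₂ > 0`. -/
theorem stmt5 :
    ∃ C : ℝ, 0 < C ∧ ∀ x₁ x₂ : ℝ, 0 < x₂ →
      Wstar x₁ x₂ ≤ C * Real.exp (-(2 * Real.pi) * (Real.sqrt (x₁ ^ 2 + x₂) - x₁)) := by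
  refine ⟨1 / 4, by norm_num, fun x₁ x₂ hx => ?_⟩
  have hr : 0 < Real.sqrt (x₁ ^ 2 + x₂) := Real.sqrt_pos.2 (by positivity)
  have hsq : Real.sqrt (x₁ ^ 2 + x₂) ^ 2 = x₁ ^ 2 + x₂ := Real.sq_sqrt (by positivity)
  have har : x₁ < Real.sqrt (x₁ ^ 2 + x₂) := Real.lt_sqrt_of_sq_lt (by linarith)
  unfold Wstar
  generalize Real.sqrt (x₁ ^ 2 + x₂) = r at *
  have hd : 0 < r - x₁ := sub_pos.2 har
  have hx2 : Real.sqrt x₂ ≤ Real.sqrt r * Real.sqrt (2 * (r - x₁)) := by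
    rw [← Real.sqrt_mul hr.le]
    exact Real.sqrt_le_sqrt (by nlinarith [sq_nonneg (r - x₁)])
  calc (1 / 2) * Real.sqrt x₂ * ∫ t in Set.Ici (1 : ℝ),
        Real.exp (2 * Real.pi * t * x₁) * K0 (2 * Real.pi * t * r)
      ≤ (1 / 2) * (Real.sqrt r * Real.sqrt (2 * (r - x₁))) *
        (Real.exp (-(2 * Real.pi) * (r - x₁)) /
          (2 * Real.sqrt r * Real.sqrt (2 * (r - x₁)))) := by
        refine mul_le_mul (by gcongr) (integral_exp_mul_K0_le hr har) ?_ (by positivity)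
        exact integral_nonneg fun _ => mul_nonneg (Real.exp_pos _).le (K0_nonneg _)
    _ = _ := by
        have : 0 < Real.sqrt (2 * (r - x₁)) := Real.sqrt_pos.2 (by positivity)
        have : 0 < Real.sqrt r := Real.sqrt_pos.2 hr
        field_simp
        norm_num
end

section
/- Let F be a number field of degree 2 over ℚ that is totally real, let σ denote the nontrivial ℚ-algebra automorphism of F, and set Nm(x) = x·σ(x). Let 𝒪 ⊆ F be an order, i.e. a subring of F that is finitely generated as a ℤ-module and contains a ℚ-basis of F. Let I ⊆ F be a nonzero finitely generated 𝒪-submodule of F and let η ∈ F. Let U = {x ∈ F : x is a unit of 𝒪, Nm(x) = 1, and x·(I + η) = I + η}, a group acting by multiplication on S_t = {α ∈ I + η : Nm(α) = t}. Then for every ε > 0 there exists a constant C > 0 such that for every nonzero t ∈ ℚ, the number of U-orbits on S_t is finite and at most C·|t|^ε. -/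
/-- Exponential growth beats linear growth, with a constant uniform over all bases at least `2`. -/
theorem exists_natCast_add_one_le_mul_rpow_pow {ε : ℝ} (hε : 0 < ε) :
    ∃ K : ℝ, 1 ≤ K ∧ ∀ x : ℝ, 2 ≤ x → ∀ e : ℕ, (e : ℝ) + 1 ≤ K * (x ^ ε) ^ e := by
  have hδ : 0 < (2 : ℝ) ^ ε - 1 := sub_pos.2 (Real.one_lt_rpow one_lt_two hε)
  set δ : ℝ := (2 : ℝ) ^ ε - 1 with hδ_def
  refine ⟨1 + 1 / δ, le_add_of_nonneg_right (by positivity), fun x hx e => ?_⟩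
  have hx : 1 + δ ≤ x ^ ε := by
    rw [hδ_def, add_sub_cancel]
    exact Real.rpow_le_rpow zero_le_two hx hε.le
  have hpow : 1 + e * δ ≤ (x ^ ε) ^ e :=
    (one_add_mul_le_pow (by linarith) e).trans (by gcongr)
  calc (e : ℝ) + 1 ≤ (1 + 1 / δ) * (1 + e * δ) := by
        have : (1 + 1 / δ) * (1 + e * δ) = e + 1 + (e * δ + 1 / δ) := by field_simp; ring
        rw [this]
        exact le_add_of_nonneg_right (by positivity)
    _ ≤ _ := by gcongr

open UniqueFactorizationMonoid in
/-- The divisor bound: the number of ideals dividing a nonzero ideal `A` is `≪ N(A) ^ ε`. -/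
theorem Ideal.exists_ncard_dvd_le_mul_absNorm_rpow {R : Type*} [CommRing R] [IsDedekindDomain R]
    [Module.Free ℤ R] [Module.Finite ℤ R] [CharZero R] {ε : ℝ} (hε : 0 < ε) :
    ∃ C : ℝ, 0 < C ∧ ∀ A : Ideal R, A ≠ ⊥ → {J : Ideal R | J ∣ A}.Finite ∧
      ({J : Ideal R | J ∣ A}.ncard : ℝ) ≤ C * (Ideal.absNorm A : ℝ) ^ ε := by
  classical
  obtain ⟨K, hK1, hK⟩ := exists_natCast_add_one_le_mul_rpow_pow hε
  obtain ⟨B, hB⟩ := exists_nat_ge ((2 : ℝ) ^ (1 / ε))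
  have hB2 : (2 : ℝ) ≤ (B : ℝ) ^ ε := by
    calc (2 : ℝ) = ((2 : ℝ) ^ (1 / ε)) ^ ε := by
          rw [← Real.rpow_mul zero_le_two, one_div_mul_cancel hε.ne', Real.rpow_one]
      _ ≤ _ := by gcongr
  have hfin : {P : Ideal R | Ideal.absNorm P ≤ B}.Finite := Ideal.finite_setOfPred_absNorm_le B
  refine ⟨K ^ hfin.toFinset.card, by positivity, fun A hA => ?_⟩
  have hmaps : ∀ J ∈ {J : Ideal R | J ∣ A}, normalizedFactors J ∈
      (Finset.Iic (normalizedFactors A) : Set (Multiset (Ideal R))) := by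
    intro J hJ
    have hJ0 : J ≠ 0 := ne_zero_of_dvd_ne_zero hA hJ
    simpa using (dvd_iff_normalizedFactors_le_normalizedFactors hJ0 hA).1 hJ
  have hinj : Set.InjOn normalizedFactors {J : Ideal R | J ∣ A} := by
    intro J hJ J' hJ' h
    rw [← Ideal.prod_normalizedFactors_eq_self (ne_zero_of_dvd_ne_zero hA hJ), h,
      Ideal.prod_normalizedFactors_eq_self (ne_zero_of_dvd_ne_zero hA hJ')]
  refine ⟨Set.Finite.of_injOn hmaps hinj (Finset.finite_toSet _), ?_⟩
  have hcard := Set.ncard_le_ncard_of_injOn normalizedFactors hmaps hinj (Finset.finite_toSet _)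
  rw [Set.ncard_coe_finset, Multiset.card_Iic] at hcard
  set m := normalizedFactors A with hm
  have hnorm : (Ideal.absNorm A : ℝ) ^ ε =
      ∏ P ∈ m.toFinset, ((Ideal.absNorm P : ℝ) ^ ε) ^ m.count P := by
    conv_lhs => rw [← Ideal.prod_normalizedFactors_eq_self hA, ← hm, Finset.prod_multiset_count]
    rw [map_prod, Nat.cast_prod, ← Real.finsetProd_rpow _ _ (fun _ _ => Nat.cast_nonneg _)]
    refine Finset.prod_congr rfl fun P _ => ?_
    rw [map_pow, Nat.cast_pow, ← Real.rpow_natCast, ← Real.rpow_natCast,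
      ← Real.rpow_mul (Nat.cast_nonneg _), ← Real.rpow_mul (Nat.cast_nonneg _), mul_comm]
  have htwo : ∀ P ∈ m.toFinset, (2 : ℝ) ≤ Ideal.absNorm P := by
    intro P hP
    have hprime := prime_of_normalized_factor P (Multiset.mem_toFinset.1 hP)
    have h0 : Ideal.absNorm P ≠ 0 := by
      rw [Ne, Ideal.absNorm_eq_zero_iff]; exact hprime.ne_zero
    have h1 : Ideal.absNorm P ≠ 1 := by
      rw [Ne, Ideal.absNorm_eq_one_iff, ← Ideal.one_eq_top]; exact hprime.ne_one
    exact_mod_cast (by omega : 2 ≤ Ideal.absNorm P)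
  calc ({J : Ideal R | J ∣ A}.ncard : ℝ) ≤ ∏ P ∈ m.toFinset, ((m.count P : ℝ) + 1) := by
        exact_mod_cast hcard
    _ ≤ ∏ P ∈ m.toFinset, ((if Ideal.absNorm P ≤ B then K else 1) *
          ((Ideal.absNorm P : ℝ) ^ ε) ^ m.count P) := by
        refine Finset.prod_le_prod (fun _ _ => by positivity) fun P hP => ?_
        split_ifs with h
        · exact hK _ (htwo P hP) _
        · have : (2 : ℝ) ≤ (Ideal.absNorm P : ℝ) ^ ε :=
            hB2.trans (by gcongr; exact (not_le.1 h).le)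
          rw [one_mul]
          calc (m.count P : ℝ) + 1 ≤ 2 ^ m.count P := by
                exact_mod_cast Nat.lt_two_pow_self
            _ ≤ _ := by gcongr
    _ = K ^ (m.toFinset.filter fun P => Ideal.absNorm P ≤ B).card *
          (Ideal.absNorm A : ℝ) ^ ε := by
        rw [Finset.prod_mul_distrib, hnorm, Finset.prod_ite, Finset.prod_const, Finset.prod_const_one,
          mul_one]
    _ ≤ _ := by
        refine mul_le_mul_of_nonneg_right (pow_le_pow_right₀ hK1 (Finset.card_le_card ?_))
          (by positivity)
        intro P hP
        simpa using (Finset.mem_filter.1 hP).2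

/-- Finitely many elements with a nonzero integer multiple in `G` have a common such multiplier. -/
theorem AddSubgroup.exists_common_zsmul_mem {A : Type*} [AddCommGroup A] (G : AddSubgroup A)
    (s : Finset A) (h : ∀ x ∈ s, ∃ k : ℤ, k ≠ 0 ∧ k • x ∈ G) :
    ∃ k : ℤ, k ≠ 0 ∧ ∀ x ∈ s, k • x ∈ G := by
  classical
  induction s using Finset.induction_on with
  | empty => exact ⟨1, one_ne_zero, by simp⟩
  | insert a s _ ih =>
    obtain ⟨k, hk, hks⟩ := ih fun x hx => h x (Finset.mem_insert_of_mem hx)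
    obtain ⟨l, hl, hla⟩ := h a (Finset.mem_insert_self _ _)
    refine ⟨k * l, mul_ne_zero hk hl, fun x hx => ?_⟩
    rcases Finset.mem_insert.1 hx with rfl | hx
    · rw [mul_smul]; exact G.zsmul_mem hla k
    · rw [mul_comm, mul_smul]; exact G.zsmul_mem (hks x hx) l

/-- If every element of a finitely generated abelian group `M` has a nonzero multiple mapped into
`G`, then one nonzero multiple of `M` is mapped into `G`. -/
theorem AddSubgroup.exists_zsmul_map_mem {M A : Type*} [AddCommGroup M] [Module.Finite ℤ M]
    [AddCommGroup A] (f : M →+ A) (G : AddSubgroup A)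
    (h : ∀ x : M, ∃ k : ℤ, k ≠ 0 ∧ k • f x ∈ G) :
    ∃ k : ℤ, k ≠ 0 ∧ ∀ x : M, k • f x ∈ G := by
  obtain ⟨s, hs⟩ := Module.Finite.fg_top (R := ℤ) (M := M)
  obtain ⟨k, hk, hks⟩ := (G.comap f).exists_common_zsmul_mem s fun x _ => by
    simpa using h x
  refine ⟨k, hk, fun x => ?_⟩
  have hx : x ∈ Submodule.span ℤ (s : Set M) := hs ▸ Submodule.mem_top
  induction hx using Submodule.span_induction with
  | mem x hx => simpa using hks x hx
  | zero => simp
  | add x y _ _ hx hy => rw [map_add, smul_add]; exact G.add_mem hx hy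
  | smul a x _ hx => rw [map_zsmul, smul_comm]; exact G.zsmul_mem hx a

/-- If a subring of `F` spans `F` over `ℚ`, each element of `F` has a nonzero multiple in it. -/
theorem Subalgebra.exists_zsmul_mem_of_span_eq_top {F : Type*} [Field F] [CharZero F]
    (O : Subalgebra ℤ F) (hO : Submodule.span ℚ (O : Set F) = ⊤) (x : F) :
    ∃ k : ℤ, k ≠ 0 ∧ k • x ∈ O := by
  have hx : x ∈ Submodule.span ℚ (O : Set F) := hO ▸ Submodule.mem_top
  induction hx using Submodule.span_induction with
  | mem x hx => exact ⟨1, one_ne_zero, by simpa using hx⟩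
  | zero => exact ⟨1, one_ne_zero, by simp⟩
  | add x y _ _ hx hy =>
    obtain ⟨k, hk, hkx⟩ := hx
    obtain ⟨l, hl, hly⟩ := hy
    refine ⟨k * l, mul_ne_zero hk hl, ?_⟩
    rw [smul_add]
    refine O.add_mem ?_ ?_
    · rw [mul_comm, mul_smul]; exact O.smul_mem hkx l
    · rw [mul_smul]; exact O.smul_mem hly k
  | smul q x _ hx =>
    obtain ⟨k, hk, hkx⟩ := hx
    refine ⟨k * q.den, mul_ne_zero hk (by exact_mod_cast q.den_nz), ?_⟩
    have : (k * (q.den : ℤ)) • q • x = q.num • k • x := by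
      simp only [Rat.smul_def, zsmul_eq_mul]
      push_cast
      have h : (q : F) * q.den = q.num := by exact_mod_cast Rat.mul_den_eq_num q
      rw [← h]; ring
    rw [this]
    exact O.smul_mem hkx _

/-- An element of a number field has a nonzero integral multiple. -/
theorem NumberField.exists_zsmul_isIntegral {F : Type*} [Field F] [NumberField F] (x : F) :
    ∃ k : ℤ, k ≠ 0 ∧ IsIntegral ℤ (k • x) := by
  have hx : IsAlgebraic ℤ x :=
    (IsFractionRing.isAlgebraic_iff ℤ ℚ F).2 (Algebra.IsAlgebraic.isAlgebraic x)
  exact hx.exists_integral_multiple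

/-- The elements of a translate of a finitely generated module over an order have bounded
denominator. -/
theorem NumberField.exists_zsmul_isIntegral_of_sub_mem {F : Type*} [Field F] [NumberField F]
    (O : Subalgebra ℤ F) (hO : (Subalgebra.toSubmodule O).FG) (I : Submodule O F) (hI : I.FG)
    (η : F) :
    ∃ D : ℤ, D ≠ 0 ∧ ∀ α : F, α - η ∈ I → IsIntegral ℤ (D • α) := by
  classical
  obtain ⟨s, rfl⟩ := hI
  obtain ⟨D, hD, hDs⟩ := (integralClosure ℤ F).toSubring.toAddSubgroup.exists_common_zsmul_mem
    (insert η s) fun x _ => NumberField.exists_zsmul_isIntegral x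
  have hη : IsIntegral ℤ (D • η) := hDs η (Finset.mem_insert_self _ _)
  refine ⟨D, hD, fun α hα => ?_⟩
  suffices h : IsIntegral ℤ (D • (α - η)) by
    simpa [smul_sub] using h.add hη
  generalize α - η = β at hα ⊢
  induction hα using Submodule.span_induction with
  | mem x hx => exact hDs x (Finset.mem_insert_of_mem hx)
  | zero => simpa using isIntegral_zero
  | add x y _ _ hx hy => rw [smul_add]; exact hx.add hy
  | smul a x _ hx =>
    have ha : IsIntegral ℤ (a : F) := IsIntegral.of_mem_of_fg O hO a a.2
    have : D • a • x = (a : F) * D • x := by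
      rw [mul_smul_comm]; rfl
    rw [this]
    exact ha.mul hx

open NumberField in
/-- A unit of the maximal order that is congruent to `1` modulo a sufficiently divisible integer
lies in the order `O` together with its inverse, and preserves the coset `I + η`. -/
theorem NumberField.mem_order_and_image_coset_eq {F : Type*} [Field F] {O : Subalgebra ℤ F}
    {I : Submodule O F} {η : F} {M : ℤ} (hMO : ∀ c : 𝓞 F, M • (c : F) ∈ O)
    (hMI : ∀ c : 𝓞 F, M • ((c : F) * η) ∈ I) {u v : 𝓞 F} (huv : u * v = 1)
    (hu : u - 1 ∈ Ideal.span {(M : 𝓞 F)}) :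
    (u : F) ∈ O ∧ (v : F) ∈ O ∧
      (fun α => (u : F) * α) '' {α : F | α - η ∈ I} = {α : F | α - η ∈ I} := by
  have hv : v - 1 ∈ Ideal.span {(M : 𝓞 F)} := by
    have : v - 1 = -v * (u - 1) := by linear_combination huv
    rw [this]
    exact Ideal.mul_mem_left _ _ hu
  have key : ∀ w : 𝓞 F, w - 1 ∈ Ideal.span {(M : 𝓞 F)} →
      (w : F) ∈ O ∧ ∀ α : F, α - η ∈ I → (w : F) * α - η ∈ I := by
    intro w hw
    obtain ⟨c, hc⟩ := Ideal.mem_span_singleton'.1 hw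
    have hcF : (w : F) = 1 + M • (c : F) := by
      have := congrArg (algebraMap (𝓞 F) F) hc
      simp only [map_mul, map_sub, map_one, map_intCast] at this
      rw [zsmul_eq_mul]
      linear_combination -this
    have hwO : (w : F) ∈ O := hcF ▸ O.add_mem O.one_mem (hMO c)
    refine ⟨hwO, fun α hα => ?_⟩
    have : (w : F) * α - η = (⟨w, hwO⟩ : O) • (α - η) + M • ((c : F) * η) := by
      rw [Subalgebra.smul_def, smul_eq_mul, ← smul_mul_assoc]
      linear_combination η * hcF
    rw [this]
    exact I.add_mem (I.smul_mem _ hα) (hMI c)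
  refine ⟨(key u hu).1, (key v hv).1, Set.Subset.antisymm ?_ fun α hα => ?_⟩
  · rintro _ ⟨α, hα, rfl⟩
    exact (key u hu).2 α hα
  · refine ⟨(v : F) * α, (key v hv).2 α hα, ?_⟩
    have huvF : (u : F) * v = 1 := by rw [← map_mul, huv, map_one]
    simp only
    rw [← mul_assoc, huvF, one_mul]

/-- A map separating the classes of `r` with values in a finite set bounds the size of `Quot r`. -/
theorem Quot.finite_and_card_le_of_mapsTo {S T : Type*} {r : S → S → Prop} {s : Set T}
    (hs : s.Finite) (f : S → T) (hfs : ∀ a, f a ∈ s) (hf : ∀ a b, f a = f b → r a b) :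
    Finite (Quot r) ∧ Nat.card (Quot r) ≤ s.ncard := by
  have := hs.to_subtype
  let g : Quot r → s := fun q => ⟨f q.out, hfs _⟩
  have hg : Function.Injective g := by
    intro p q h
    rw [← Quot.out_eq p, ← Quot.out_eq q]
    exact Quot.sound (hf _ _ (Subtype.ext_iff.1 h))
  exact ⟨Finite.of_injective g hg, Nat.card_le_card_of_injective g hg⟩

open NumberField in
/-- In a quadratic field, an algebraic integer `a` whose norm `a * σ a` is rational divides an
integer `n` of the same value. -/
theorem NumberField.exists_int_eq_of_mul_eq {F : Type*} [Field F] [NumberField F] (σ : F ≃ₐ[ℚ] F)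
    {a : 𝓞 F} {q : ℚ} (h : (a : F) * σ a = algebraMap ℚ F q) :
    ∃ n : ℤ, (n : ℚ) = q ∧ a ∣ (n : 𝓞 F) := by
  have hσ : IsIntegral ℤ (σ a) :=
    (RingOfIntegers.isIntegral_coe a).map (σ.toAlgHom.restrictScalars ℤ)
  have hq : IsIntegral ℤ q := by
    rw [← isIntegral_algebraMap_iff (algebraMap ℚ F).injective, ← h]
    exact (RingOfIntegers.isIntegral_coe a).mul hσ
  obtain ⟨n, rfl⟩ := IsIntegrallyClosed.isIntegral_iff.1 hq
  refine ⟨n, rfl, ⟨⟨σ a, hσ⟩, ?_⟩⟩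
  apply RingOfIntegers.ext
  have hn : (a : F) * σ a = (n : F) := by simpa using h
  exact (map_intCast (algebraMap (𝓞 F) F) n).trans <|
    hn.symm.trans (map_mul (algebraMap (𝓞 F) F) a ⟨σ a, hσ⟩).symm

open NumberField in
/-- Bound on indefinite representation numbers in a real quadratic order, part (i):
for a totally real quadratic field `F` with nontrivial automorphism `σ`, an order `𝒪`,
a nonzero finitely generated `𝒪`-submodule `I ⊆ F` and `η ∈ F`, the number of orbits
of the group `U = {x ∈ 𝒪ˣ : Nm(x) = 1, x(I+η) = I+η}` on
`S_t = {α ∈ I+η : Nm(α) = t}` is finite and `≪ |t|^ε` for every `ε > 0`. -/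
theorem stmt7 {F : Type*} [Field F] [NumberField F]
    (hdeg : Module.finrank ℚ F = 2)
    (htotreal : ∀ φ : F →+* ℂ, ∀ x : F, (φ x).im = 0)
    (σ : F ≃ₐ[ℚ] F) (hσ : σ ≠ AlgEquiv.refl)
    (O : Subalgebra ℤ F)
    (hOfg : (Subalgebra.toSubmodule O).FG)
    (hOspan : Submodule.span ℚ (O : Set F) = ⊤)
    (I : Submodule O F) (hIne : I ≠ ⊥) (hIfg : I.FG)
    (η : F) :
    ∀ ε : ℝ, 0 < ε → ∃ C : ℝ, 0 < C ∧ ∀ t : ℚ, t ≠ 0 →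
      let coset : Set F := {α : F | α - η ∈ I}
      let U : Set F := {x : F | x ∈ O ∧ (∃ y ∈ O, x * y = 1) ∧ x * σ x = 1 ∧
        (fun α => x * α) '' coset = coset}
      let S : Set F := {α : F | α ∈ coset ∧ α * σ α = algebraMap ℚ F t}
      Finite (Quot (fun (α β : ↥S) => ∃ x ∈ U, x * (α : F) = (β : F))) ∧
      (Nat.card (Quot (fun (α β : ↥S) => ∃ x ∈ U, x * (α : F) = (β : F))) : ℝ) ≤
        C * |(t : ℝ)| ^ ε := by
  classical
  intro ε hε
  obtain ⟨D, hD, hDint⟩ := NumberField.exists_zsmul_isIntegral_of_sub_mem O hOfg I hIfg η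
  have hmulO := O.exists_zsmul_mem_of_span_eq_top hOspan
  have hmulI : ∀ x : F, ∃ k : ℤ, k ≠ 0 ∧ k • x ∈ I := by
    intro x
    obtain ⟨b, hb, hb0⟩ := I.exists_mem_ne_zero_of_ne_bot hIne
    obtain ⟨k, hk, hkx⟩ := hmulO (x / b)
    refine ⟨k, hk, ?_⟩
    have : k • x = (⟨_, hkx⟩ : O) • b := by
      rw [Subalgebra.smul_def, smul_eq_mul, smul_mul_assoc, div_mul_cancel₀ _ hb0]
    rw [this]
    exact I.smul_mem _ hb
  obtain ⟨M₁, hM₁, hM₁O⟩ := AddSubgroup.exists_zsmul_map_mem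
    (algebraMap (𝓞 F) F).toAddMonoidHom O.toSubring.toAddSubgroup fun c => hmulO c
  obtain ⟨M₂, hM₂, hM₂I⟩ := AddSubgroup.exists_zsmul_map_mem
    ((AddMonoidHom.mulRight η).comp (algebraMap (𝓞 F) F).toAddMonoidHom) I.toAddSubgroup
    fun c => hmulI (c * η)
  set M : ℤ := M₁ * M₂ with hM
  have hM0 : (M : 𝓞 F) ≠ 0 := by exact_mod_cast mul_ne_zero hM₁ hM₂
  have hMO : ∀ c : 𝓞 F, M • (c : F) ∈ O := fun c => by
    rw [hM, mul_comm, mul_smul]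
    exact O.smul_mem (hM₁O c) _
  have hMI : ∀ c : 𝓞 F, M • ((c : F) * η) ∈ I := fun c => by
    rw [hM, mul_smul]
    exact I.toAddSubgroup.zsmul_mem (hM₂I c) _
  let Q : Ideal (𝓞 F) := Ideal.span {(M : 𝓞 F)}
  have hQ : Finite (𝓞 F ⧸ Q) := Ideal.finiteQuotientOfFreeOfNeBot Q <| by
    rwa [Ne, Ideal.span_singleton_eq_bot]
  obtain ⟨C, hC, hdiv⟩ :=
    Ideal.exists_ncard_dvd_le_mul_absNorm_rpow (R := 𝓞 F) (half_pos hε)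
  have hDpos : (0 : ℝ) < |(D : ℝ)| := abs_pos.2 (by exact_mod_cast hD)
  have hQpos : 0 < Nat.card (𝓞 F ⧸ Q) := Nat.card_pos
  refine ⟨C * (|(D : ℝ)| ^ 2) ^ ε * Nat.card (𝓞 F ⧸ Q), by positivity, fun t ht => ?_⟩
  intro coset U S
  rcases isEmpty_or_nonempty S with hS | ⟨⟨α₀⟩⟩
  · refine ⟨inferInstance, ?_⟩
    rw [Nat.card_of_isEmpty, Nat.cast_zero]
    positivity
  let a : S → 𝓞 F := fun α => ⟨D • (α : F), hDint α α.2.1⟩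
  have ha : ∀ α, (a α : F) = D * α := fun α => zsmul_eq_mul _ _
  have hanorm : ∀ α, (a α : F) * σ (a α) = algebraMap ℚ F (D ^ 2 * t) := by
    intro α
    have h : (α : F) * σ α = algebraMap ℚ F t := α.2.2
    rw [ha, map_mul, map_intCast, map_mul, ← h, map_pow, map_intCast]
    ring
  have hDt : (D : ℚ) ^ 2 * t ≠ 0 := mul_ne_zero (pow_ne_zero _ (by exact_mod_cast hD)) ht
  obtain ⟨n, hn, -⟩ := NumberField.exists_int_eq_of_mul_eq σ (hanorm α₀)
  have hn0 : n ≠ 0 := by rintro rfl; exact hDt (by simpa using hn.symm)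
  have hadvd : ∀ α, Ideal.span {a α} ∣ Ideal.span {(n : 𝓞 F)} := by
    intro α
    obtain ⟨n', hn', hdvd⟩ := NumberField.exists_int_eq_of_mul_eq σ (hanorm α)
    obtain rfl : n' = n := by exact_mod_cast hn'.trans hn.symm
    rwa [Ideal.dvd_span_singleton, Ideal.mem_span_singleton]
  have hgen : ∀ J : Ideal (𝓞 F), ∃ g : 𝓞 F, ∀ b, J = Ideal.span {b} → Associated g b := by
    intro J
    by_cases h : ∃ g, J = Ideal.span {g}
    · obtain ⟨g, rfl⟩ := h
      exact ⟨g, fun b hb => Ideal.span_singleton_eq_span_singleton.1 hb⟩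
    · exact ⟨0, fun b hb => (h ⟨b, hb⟩).elim⟩
  choose gen hgen using hgen
  choose u hu using fun α : S => hgen (Ideal.span {a α}) (a α) rfl
  let f : S → Ideal (𝓞 F) × (𝓞 F ⧸ Q) := fun α =>
    (Ideal.span {a α}, Ideal.Quotient.mk Q (u α))
  have hnbot : Ideal.span {(n : 𝓞 F)} ≠ ⊥ := by
    rw [Ne, Ideal.span_singleton_eq_bot]
    exact_mod_cast hn0
  obtain ⟨hfin, hcard⟩ := hdiv _ hnbot
  have hf : ∀ α β : S, f α = f β → ∃ x ∈ U, x * (α : F) = (β : F) := by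
    intro α β h
    obtain ⟨hJ, hmod⟩ := Prod.ext_iff.1 h
    have hJ : Ideal.span {a α} = Ideal.span {a β} := hJ
    have hmod : (u β : 𝓞 F) - u α ∈ Q := Ideal.Quotient.eq.1 hmod.symm
    set x : (𝓞 F)ˣ := u β * (u α)⁻¹ with hx
    have hx1 : (x : 𝓞 F) - 1 ∈ Q := by
      have : (x : 𝓞 F) - 1 = ((u α)⁻¹ : (𝓞 F)ˣ) * ((u β : 𝓞 F) - u α) := by
        rw [mul_sub, Units.inv_mul, hx, Units.val_mul, mul_comm]
      rw [this]
      exact Q.mul_mem_left _ hmod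
    obtain ⟨hxO, hyO, himage⟩ :=
      NumberField.mem_order_and_image_coset_eq hMO hMI (Units.mul_inv x) hx1
    have hxa : (x : 𝓞 F) * a α = a β := by
      rw [← hu α, ← hu β, hJ, hx, Units.val_mul]
      linear_combination (gen (Ideal.span {a β})) * (u β : 𝓞 F) * (u α).inv_mul
    have hxaF : ((x : 𝓞 F) : F) * a α = a β :=
      (map_mul (algebraMap (𝓞 F) F) _ _).symm.trans (congrArg (algebraMap (𝓞 F) F) hxa)
    refine ⟨(x : 𝓞 F), ⟨hxO, ⟨_, hyO, ?_⟩, ?_, himage⟩, ?_⟩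
    · rw [← map_mul, Units.mul_inv, map_one]
    · have hβ := hanorm β
      rw [← hxaF, map_mul, mul_mul_mul_comm, hanorm α] at hβ
      exact mul_eq_right₀ ((map_ne_zero _).2 hDt) |>.1 hβ
    · rw [ha, ha] at hxaF
      have hDF : (D : F) ≠ 0 := by exact_mod_cast hD
      apply mul_left_cancel₀ hDF
      linear_combination hxaF
  obtain ⟨hQuot, hle⟩ := Quot.finite_and_card_le_of_mapsTo
    (hfin.prod (Set.finite_univ (α := 𝓞 F ⧸ Q))) f (fun α => ⟨hadvd α, Set.mem_univ _⟩) hf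
  refine ⟨hQuot, ?_⟩
  rw [Set.ncard_prod, Set.ncard_univ] at hle
  have hnorm : (Ideal.absNorm (Ideal.span {(n : 𝓞 F)}) : ℝ) ^ (ε / 2) =
      (|(D : ℝ)| ^ 2) ^ ε * |(t : ℝ)| ^ ε := by
    have hnR : (n : ℝ) = (D : ℝ) ^ 2 * t := by exact_mod_cast congrArg (Rat.cast : ℚ → ℝ) hn
    have : (Ideal.absNorm (Ideal.span {(n : 𝓞 F)}) : ℝ) = |(n : ℝ)| ^ (2 : ℝ) := by
      rw [Ideal.absNorm_span_singleton, ← eq_intCast (algebraMap ℤ (𝓞 F)) n,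
        Algebra.norm_algebraMap, RingOfIntegers.rank, hdeg, Int.natAbs_pow]
      push_cast
      rw [Nat.cast_natAbs, Int.cast_abs, Real.rpow_two]
    rw [this, ← Real.rpow_mul (abs_nonneg _), mul_div_cancel₀ _ two_ne_zero, hnR, abs_mul, abs_pow,
      Real.mul_rpow (by positivity) (abs_nonneg _)]
  calc _ ≤ (({J : Ideal (𝓞 F) | J ∣ Ideal.span {(n : 𝓞 F)}}.ncard * Nat.card (𝓞 F ⧸ Q) : ℕ) : ℝ) :=
        Nat.cast_le.2 hle
    _ ≤ C * ((|(D : ℝ)| ^ 2) ^ ε * |(t : ℝ)| ^ ε) * Nat.card (𝓞 F ⧸ Q) := by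
        rw [Nat.cast_mul, ← hnorm]
        gcongr
    _ = _ := by ring
end

section
/- Let F be a number field of degree 2 over ℚ that is totally real, let σ denote the nontrivial ℚ-algebra automorphism of F, set Nm(x) = x·σ(x) and Tr'(x,y) = x·σ(y) + y·σ(x). Let 𝒪 ⊆ F be an order, i.e. a subring of F that is finitely generated as a ℤ-module and contains a ℚ-basis of F. Let I ⊆ F be a nonzero finitely generated 𝒪-submodule of F and let η₁, η₂ ∈ F. Let U = {x ∈ F : x is a unit of 𝒪, Nm(x) = 1, x·(I + η₁) = I + η₁, and x·(I + η₂) = I + η₂}, acting diagonally by multiplication on S(t₀,t₁,t₂) = {(α₁, α₂) ∈ (I + η₁) × (I + η₂) : Nm(α₁) = t₁, Nm(α₂) = t₂, and Tr'(α₁,α₂) = t₀}. Then for every ε > 0 there exists C > 0 such that for all t₀, t₁, t₂ ∈ ℚ with t₀² − 4t₁t₂ ≠ 0, the number of U-orbits on S(t₀,t₁,t₂) is finite and at most C·|t₀² − 4t₁t₂|^ε. -/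
theorem add_one_le_mul_rpow_pow {ε K x : ℝ} (hε : 0 < ε) (hK : 1 ≤ K)
    (hKε : 1 ≤ K * (ε * Real.log 2)) (hx : 2 ≤ x) (k : ℕ) :
    (k : ℝ) + 1 ≤ (if x ^ ε < 2 then K else 1) * (x ^ ε) ^ k := by
  split_ifs with h
  · have hL : ε * Real.log 2 + 1 ≤ x ^ ε := calc
      ε * Real.log 2 + 1 ≤ Real.exp (ε * Real.log 2) := Real.add_one_le_exp _
      _ = (2 : ℝ) ^ ε := by rw [Real.rpow_def_of_pos two_pos, mul_comm]
      _ ≤ x ^ ε := Real.rpow_le_rpow two_pos.le hx hε.le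
    have h0 : 0 < ε * Real.log 2 := mul_pos hε (Real.log_pos one_lt_two)
    have hB := one_add_mul_le_pow (a := ε * Real.log 2) (by linarith) k
    have hP : (1 + ε * Real.log 2) ^ k ≤ (x ^ ε) ^ k :=
      pow_le_pow_left₀ (by linarith) (by linarith) k
    have hk : (0 : ℝ) ≤ k := k.cast_nonneg
    calc (k : ℝ) + 1 ≤ K * (1 + k * (ε * Real.log 2)) := by nlinarith
      _ ≤ K * (x ^ ε) ^ k := by gcongr; linarith
  · rw [one_mul]
    have h2 : ((k + 1 : ℕ) : ℝ) ≤ (2 : ℝ) ^ k := by exact_mod_cast k.lt_two_pow_self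
    push_cast at h2
    exact h2.trans (pow_le_pow_left₀ two_pos.le (not_lt.mp h) k)

open UniqueFactorizationMonoid in
/-- The divisor bound for nonzero ideals: `A` has `≪ N(A) ^ ε` divisors. -/
theorem Ideal.exists_card_dvd_le_absNorm_rpow (R : Type*) [CommRing R] [IsDedekindDomain R]
    [Module.Free ℤ R] [Module.Finite ℤ R] [CharZero R] {ε : ℝ} (hε : 0 < ε) :
    ∃ C : ℝ, 0 < C ∧ ∀ A : Ideal R, A ≠ ⊥ → Finite {J : Ideal R // J ∣ A} ∧
      (Nat.card {J : Ideal R // J ∣ A} : ℝ) ≤ C * (Ideal.absNorm A : ℝ) ^ ε := by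
  classical
  set K : ℝ := max 1 (ε * Real.log 2)⁻¹
  have hK : 1 ≤ K := le_max_left _ _
  have h0 : 0 < ε * Real.log 2 := mul_pos hε (Real.log_pos one_lt_two)
  have hKε : 1 ≤ K * (ε * Real.log 2) := by
    rw [← inv_mul_cancel₀ h0.ne']
    gcongr
    exact le_max_right _ _
  set small : Set (Ideal R) := {P | (Ideal.absNorm P : ℝ) ^ ε < 2}
  have hfin : small.Finite := by
    refine (Ideal.finite_setOfPred_absNorm_le (S := R) ⌊(2 : ℝ) ^ ε⁻¹⌋₊).subset fun P hP ↦ ?_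
    refine Nat.le_floor ?_
    have := Real.rpow_le_rpow (by positivity) hP.le (inv_pos.mpr hε).le
    rwa [← Real.rpow_mul (by positivity), mul_inv_cancel₀ hε.ne', Real.rpow_one] at this
  refine ⟨K ^ hfin.toFinset.card, by positivity, fun A hA ↦ ?_⟩
  set s := normalizedFactors A
  have hne : ∀ J : {J : Ideal R // J ∣ A}, J.1 ≠ 0 := fun J h ↦ hA (by
    have := J.2
    rwa [h, zero_dvd_iff] at this)
  let f : {J : Ideal R // J ∣ A} → Finset.Iic s := fun J ↦
    ⟨normalizedFactors J.1, Finset.mem_Iic.mpr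
      ((dvd_iff_normalizedFactors_le_normalizedFactors (hne J) hA).mp J.2)⟩
  have hf : Function.Injective f := fun J J' h ↦ by
    have h' : normalizedFactors J.1 = normalizedFactors J'.1 := congrArg Subtype.val h
    refine Subtype.ext ?_
    rw [← prod_normalizedFactors_eq_self (hne J), h', prod_normalizedFactors_eq_self (hne J')]
  refine ⟨Finite.of_injective f hf, ?_⟩
  have hcard : Nat.card {J : Ideal R // J ∣ A} ≤ ∏ P ∈ s.toFinset, (s.count P + 1) := by
    rw [← Multiset.card_Iic, ← Fintype.card_coe, ← Nat.card_eq_fintype_card]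
    exact Nat.card_le_card_of_injective f hf
  have hnorm : (Ideal.absNorm A : ℝ) ^ ε
      = ∏ P ∈ s.toFinset, ((Ideal.absNorm P : ℝ) ^ ε) ^ s.count P := by
    conv_lhs => rw [← prod_normalizedFactors_eq_self hA, Finset.prod_multiset_count]
    rw [map_prod, Nat.cast_prod, ← Real.finsetProd_rpow _ _ fun _ _ ↦ Nat.cast_nonneg _]
    refine Finset.prod_congr rfl fun P _ ↦ ?_
    rw [map_pow, Nat.cast_pow, Real.rpow_pow_comm (Nat.cast_nonneg _)]
  have hprod : ∏ P ∈ s.toFinset, (if (Ideal.absNorm P : ℝ) ^ ε < 2 then K else 1)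
      ≤ K ^ hfin.toFinset.card := by
    rw [Finset.prod_ite, Finset.prod_const_one, mul_one, Finset.prod_const]
    refine pow_le_pow_right₀ hK (Finset.card_le_card fun P hP ↦ ?_)
    exact hfin.mem_toFinset.mpr (Finset.mem_filter.mp hP).2
  calc (Nat.card {J : Ideal R // J ∣ A} : ℝ)
      ≤ ∏ P ∈ s.toFinset, ((s.count P : ℝ) + 1) := by exact_mod_cast hcard
    _ ≤ ∏ P ∈ s.toFinset, ((if (Ideal.absNorm P : ℝ) ^ ε < 2 then K else 1) *
          ((Ideal.absNorm P : ℝ) ^ ε) ^ s.count P) := by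
        refine Finset.prod_le_prod (fun _ _ ↦ by positivity) fun P hP ↦ ?_
        have hPp : Prime P := prime_of_normalized_factor P (Multiset.mem_toFinset.mp hP)
        refine add_one_le_mul_rpow_pow hε hK hKε ?_ _
        have h1 : Ideal.absNorm P ≠ 0 := Ideal.absNorm_eq_zero_iff.not.mpr hPp.ne_zero
        have h2 : Ideal.absNorm P ≠ 1 := fun h ↦
          hPp.not_isUnit (Ideal.isUnit_iff.mpr (Ideal.absNorm_eq_one_iff.mp h))
        exact_mod_cast (by omega : 2 ≤ Ideal.absNorm P)
    _ ≤ K ^ hfin.toFinset.card * (Ideal.absNorm A : ℝ) ^ ε := by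
        rw [Finset.prod_mul_distrib, hnorm]
        exact mul_le_mul_of_nonneg_right hprod (Finset.prod_nonneg fun _ _ ↦ by positivity)

open NumberField

/-- A finitely generated group `N` is carried into `M` by a nonzero integer as soon as every
element is. -/
theorem Submodule.FG.exists_int_smul_mem {G : Type*} [AddCommGroup G] {N : Submodule ℤ G}
    (hN : N.FG) (M : Submodule ℤ G) (hM : ∀ y : G, ∃ f : ℤ, f ≠ 0 ∧ f • y ∈ M) :
    ∃ f : ℤ, f ≠ 0 ∧ ∀ x ∈ N, f • x ∈ M := by
  induction N, hN using Submodule.fg_induction with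
  | singleton x =>
    obtain ⟨f, hf, hx⟩ := hM x
    refine ⟨f, hf, fun y hy ↦ ?_⟩
    obtain ⟨c, rfl⟩ := Submodule.mem_span_singleton.mp hy
    rw [smul_comm]
    exact M.smul_mem c hx
  | sup N₁ N₂ _ _ h₁ h₂ =>
    obtain ⟨f, hf, h₁⟩ := h₁
    obtain ⟨g, hg, h₂⟩ := h₂
    refine ⟨f * g, mul_ne_zero hf hg, fun x hx ↦ ?_⟩
    obtain ⟨y, hy, z, hz, rfl⟩ := Submodule.mem_sup.mp hx
    rw [smul_add]
    refine M.add_mem ?_ ?_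
    · rw [mul_comm, mul_smul]
      exact M.smul_mem g (h₁ y hy)
    · rw [mul_smul]
      exact M.smul_mem f (h₂ z hz)

theorem exists_int_smul_mem_of_mem_span_rat {V : Type*} [AddCommGroup V] [Module ℚ V]
    (M : Submodule ℤ V) {y : V} (hy : y ∈ Submodule.span ℚ (M : Set V)) :
    ∃ f : ℤ, f ≠ 0 ∧ f • y ∈ M := by
  induction hy using Submodule.span_induction with
  | mem x hx => exact ⟨1, one_ne_zero, by rwa [one_smul]⟩
  | zero => exact ⟨1, one_ne_zero, by simp⟩
  | add x y _ _ hx hy =>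
    obtain ⟨f, hf, hx⟩ := hx
    obtain ⟨g, hg, hy⟩ := hy
    refine ⟨f * g, mul_ne_zero hf hg, ?_⟩
    rw [smul_add]
    refine M.add_mem ?_ ?_
    · rw [mul_comm, mul_smul]
      exact M.smul_mem g hx
    · rw [mul_smul]
      exact M.smul_mem f hy
  | smul a x _ hx =>
    obtain ⟨f, hf, hx⟩ := hx
    refine ⟨f * a.den, mul_ne_zero hf (by exact_mod_cast a.den_nz), ?_⟩
    have : (f * a.den : ℤ) • a • x = a.num • f • x := by
      simp only [← Int.cast_smul_eq_zsmul ℚ, smul_smul]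
      congr 1
      push_cast
      rw [mul_assoc, Rat.den_mul_eq_num, mul_comm]
    rw [this]
    exact M.smul_mem _ hx

/-- Some nonzero integer multiplies a finitely generated module over an order, together with a
finite set, into the ring of integers. -/
theorem exists_int_smul_isIntegral {F : Type*} [Field F] [NumberField F]
    {O : Subalgebra ℤ F} (hO : (Subalgebra.toSubmodule O).FG)
    {I : Submodule O F} (hI : I.FG) (η₁ η₂ : F) :
    ∃ m : ℤ, m ≠ 0 ∧ ∀ α, (α - η₁ ∈ I ∨ α - η₂ ∈ I) → IsIntegral ℤ (m • α) := by
  classical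
  obtain ⟨s, rfl⟩ := hI
  obtain ⟨m, hm, h⟩ := exists_integral_multiples ℤ ℚ (L := F) (insert η₁ (insert η₂ s))
  have hintegral : ∀ x ∈ Submodule.span O (s : Set F), IsIntegral ℤ (m • x) := fun x hx ↦ by
    induction hx using Submodule.span_induction with
    | mem x hx => exact h x (by simp [Finset.mem_coe.mp hx])
    | zero => rw [smul_zero]; exact isIntegral_zero
    | add x y _ _ hx hy => rw [smul_add]; exact hx.add hy
    | smul a x _ hx =>
      have ha : IsIntegral ℤ (a : F) := by
        have : Module.Finite ℤ O := Module.Finite.iff_fg.mpr hO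
        exact (Algebra.IsIntegral.isIntegral (R := ℤ) a).map O.val
      rw [smul_comm, Subalgebra.smul_def, smul_eq_mul]
      exact ha.mul hx
  refine ⟨m, hm, fun α hα ↦ ?_⟩
  rcases hα with hα | hα
  · have := (hintegral _ hα).add (h η₁ (by simp))
    rwa [← smul_add, sub_add_cancel] at this
  · have := (hintegral _ hα).add (h η₂ (by simp))
    rwa [← smul_add, sub_add_cancel] at this

/-- The conductor-like integer `f`: it multiplies the integers of `F` into the order `O`,
and their multiples of `η` into `I`. -/
theorem exists_int_smul_mem_order {F : Type*} [Field F] [NumberField F]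
    {O : Subalgebra ℤ F}
    (hOspan : Submodule.span ℚ (O : Set F) = ⊤)
    {I : Submodule O F} (hI : I ≠ ⊥) (η₁ η₂ : F) :
    ∃ f : ℤ, f ≠ 0 ∧ ∀ x : F, IsIntegral ℤ x →
      f • x ∈ O ∧ f • x * η₁ ∈ I ∧ f • x * η₂ ∈ I := by
  have hOall : ∀ y : F, ∃ f : ℤ, f ≠ 0 ∧ f • y ∈ O := fun y ↦
    exists_int_smul_mem_of_mem_span_rat (Subalgebra.toSubmodule O)
      (by change y ∈ Submodule.span ℚ (O : Set F); rw [hOspan]; trivial)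
  have hIall : ∀ y : F, ∃ f : ℤ, f ≠ 0 ∧ f • y ∈ I := fun y ↦ by
    obtain ⟨x, hx, hx0⟩ := Submodule.exists_mem_ne_zero_of_ne_bot hI
    obtain ⟨f, hf, hy⟩ := hOall (y / x)
    refine ⟨f, hf, ?_⟩
    have := I.smul_mem ⟨_, hy⟩ hx
    rwa [Subalgebra.smul_def, smul_eq_mul, smul_mul_assoc, div_mul_cancel₀ _ hx0] at this
  let M : Submodule ℤ F := Subalgebra.toSubmodule O ⊓
    ((I.restrictScalars ℤ).comap (LinearMap.mulRight ℤ η₁) ⊓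
      (I.restrictScalars ℤ).comap (LinearMap.mulRight ℤ η₂))
  have hM : ∀ y : F, ∃ f : ℤ, f ≠ 0 ∧ f • y ∈ M := fun y ↦ by
    obtain ⟨f, hf, h⟩ := hOall y
    obtain ⟨g, hg, h₁⟩ := hIall (y * η₁)
    obtain ⟨k, hk, h₂⟩ := hIall (y * η₂)
    refine ⟨f * g * k, by positivity, ?_, ?_, ?_⟩
    · rw [show f * g * k = (g * k) * f by ring, mul_smul]
      exact (Subalgebra.toSubmodule O).smul_mem _ h
    · change (f * g * k) • y * η₁ ∈ I.restrictScalars ℤ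
      rw [smul_mul_assoc, show f * g * k = (f * k) * g by ring, mul_smul]
      exact (I.restrictScalars ℤ).smul_mem _ h₁
    · change (f * g * k) • y * η₂ ∈ I.restrictScalars ℤ
      rw [smul_mul_assoc, mul_smul]
      exact (I.restrictScalars ℤ).smul_mem _ h₂
  have hfg : (Subalgebra.toSubmodule (integralClosure ℤ F)).FG :=
    Module.Finite.iff_fg.mp (inferInstanceAs (Module.Finite ℤ (𝓞 F)))
  obtain ⟨f, hf, h⟩ := hfg.exists_int_smul_mem M hM
  exact ⟨f, hf, fun x hx ↦ h x hx⟩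

theorem mul_mem_coset {F : Type*} [Field F]
    {O : Subalgebra ℤ F} {I : Submodule O F} {η z : F}
    (hz : z ∈ O) (hη : (z - 1) * η ∈ I) {α : F} (hα : α - η ∈ I) : z * α - η ∈ I := by
  have := I.add_mem (I.smul_mem ⟨z, hz⟩ hα) hη
  rw [Subalgebra.smul_def, smul_eq_mul] at this
  convert this using 1
  ring

theorem image_mul_coset_eq {F : Type*} [Field F]
    {O : Subalgebra ℤ F} {I : Submodule O F} {η z : F} (hz0 : z ≠ 0)
    (hz : z ∈ O) (hz' : z⁻¹ ∈ O) (hη : (z - 1) * η ∈ I) (hη' : (z⁻¹ - 1) * η ∈ I) :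
    (fun α ↦ z * α) '' {α : F | α - η ∈ I} = {α : F | α - η ∈ I} := by
  ext α
  constructor
  · rintro ⟨β, hβ, rfl⟩
    exact mul_mem_coset hz hη hβ
  · exact fun hα ↦ ⟨z⁻¹ * α, mul_mem_coset hz' hη' hα, mul_inv_cancel_left₀ hz0 α⟩

/-- The ratio of two proportional pairs generating the same ideal is integral. -/
theorem isIntegral_of_span_pair_eq {F : Type*} [Field F]
    {x : F} {a b a' b' : 𝓞 F} (ha : a ≠ 0)
    (hxa : x * a = a') (hxb : x * b = b')
    (h : Ideal.span {a', b'} = Ideal.span {a, b}) : IsIntegral ℤ x := by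
  have hmem : ∀ c ∈ Ideal.span {a, b}, (c : F) ∈ Submodule.span (𝓞 F) {(a : F), (b : F)} := by
    intro c hc
    obtain ⟨r, s, rfl⟩ := Ideal.mem_span_pair.mp hc
    exact Submodule.mem_span_pair.mpr ⟨r, s, by simp [Algebra.smul_def]⟩
  have ha₁ : a' ∈ Ideal.span {a, b} := h ▸ Ideal.subset_span (by simp)
  have hb₁ : b' ∈ Ideal.span {a, b} := h ▸ Ideal.subset_span (by simp)
  refine isIntegral_trans (A := 𝓞 F) x (isIntegral_of_smul_mem_submodule
    (Submodule.span (𝓞 F) {(a : F), (b : F)}) ?_ ?_ x ?_)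
  · exact Submodule.ne_bot_iff _ |>.mpr ⟨a, Submodule.subset_span (by simp), by simpa using ha⟩
  · exact Submodule.fg_span (by simp)
  · intro n hn
    obtain ⟨r, s, rfl⟩ := Submodule.mem_span_pair.mp hn
    rw [smul_add, smul_comm, smul_comm x s]
    refine Submodule.add_mem _ (Submodule.smul_mem _ _ ?_) (Submodule.smul_mem _ _ ?_)
    · rw [smul_eq_mul, hxa]; exact hmem _ ha₁
    · rw [smul_eq_mul, hxb]; exact hmem _ hb₁

/-- A map to a finite type whose fibres lie in single classes bounds the number of classes. -/
theorem card_quot_le_of_map {α X : Type*} [Finite X] {r : α → α → Prop} (Φ : α → X)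
    (h : ∀ p q, Φ p = Φ q → r p q) : Finite (Quot r) ∧ Nat.card (Quot r) ≤ Nat.card X := by
  have hinj : Function.Injective fun c : Quot r ↦ Φ c.out := fun a b hab ↦ by
    rw [← Quot.out_eq a, ← Quot.out_eq b]
    exact Quot.sound (h _ _ hab)
  exact ⟨Finite.of_injective _ hinj, Nat.card_le_card_of_injective _ hinj⟩

theorem exists_norm_one_ratio {F : Type*} [Field F] [Algebra ℚ F] (σ : F ≃ₐ[ℚ] F)
    {α₁ α₂ β₁ β₂ : F} (h₀ : α₁ ≠ 0) (h₁ : α₁ * σ α₁ = β₁ * σ β₁)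
    (h₂ : α₁ * σ α₂ = β₁ * σ β₂) :
    ∃ x : F, x * σ x = 1 ∧ x * α₁ = β₁ ∧ x * α₂ = β₂ := by
  have hσ : σ α₁ ≠ 0 := (map_ne_zero σ).mpr h₀
  have hβ : β₁ ≠ 0 := fun h ↦ by
    rw [h, zero_mul] at h₁
    exact mul_ne_zero h₀ hσ h₁
  have hx : β₁ / α₁ * α₁ = β₁ := div_mul_cancel₀ _ h₀
  have hxσ : β₁ / α₁ * σ (β₁ / α₁) = 1 := by
    rw [map_div₀, div_mul_div_comm, ← h₁]
    exact div_self (mul_ne_zero h₀ hσ)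
  refine ⟨β₁ / α₁, hxσ, hx, σ.injective (mul_left_cancel₀ hβ ?_)⟩
  rw [← h₂, map_mul]
  nth_rewrite 1 [← hx]
  linear_combination (α₁ * σ α₂) * hxσ

theorem absNorm_span_singleton_of_sq_eq {F : Type*} [Field F] [NumberField F]
    (hdeg : Module.finrank ℚ F = 2) {δ : 𝓞 F} {D : ℚ}
    (h : (δ : F) ^ 2 = algebraMap ℚ F D) :
    (Ideal.absNorm (Ideal.span {δ}) : ℝ) = |(D : ℝ)| := by
  have h₁ : ((Algebra.norm ℤ δ : ℤ) : ℚ) ^ 2 = D ^ 2 := by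
    rw [Algebra.coe_norm_int, ← map_pow, h, Algebra.norm_algebraMap, hdeg]
  rw [Ideal.absNorm_span_singleton, Nat.cast_natAbs, Int.cast_abs]
  refine (sq_eq_sq_iff_abs_eq_abs _ _).mp ?_
  exact_mod_cast h₁

/-- Bound on indefinite representation numbers in a real quadratic order, part (ii):
with `Nm(x) = xσ(x)` and `Tr'(x,y) = xσ(y) + yσ(x)`, the number of orbits of
`U = {x ∈ 𝒪ˣ : Nm(x) = 1, x(I+η₁) = I+η₁, x(I+η₂) = I+η₂}` acting diagonally on
`S(t₀,t₁,t₂) = {(α₁,α₂) ∈ (I+η₁)×(I+η₂) : Nm(αᵢ) = tᵢ, Tr'(α₁,α₂) = t₀}` is finite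
and `≪ |t₀² − 4t₁t₂|^ε` for every `ε > 0`. -/
theorem stmt8 {F : Type*} [Field F] [NumberField F]
    (hdeg : Module.finrank ℚ F = 2)
    (htotreal : ∀ φ : F →+* ℂ, ∀ x : F, (φ x).im = 0)
    (σ : F ≃ₐ[ℚ] F) (hσ : σ ≠ AlgEquiv.refl)
    (O : Subalgebra ℤ F)
    (hOfg : (Subalgebra.toSubmodule O).FG)
    (hOspan : Submodule.span ℚ (O : Set F) = ⊤)
    (I : Submodule O F) (hIne : I ≠ ⊥) (hIfg : I.FG)
    (η₁ η₂ : F) :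
    ∀ ε : ℝ, 0 < ε → ∃ C : ℝ, 0 < C ∧
      ∀ t₀ t₁ t₂ : ℚ, t₀ ^ 2 - 4 * t₁ * t₂ ≠ 0 →
      let coset₁ : Set F := {α : F | α - η₁ ∈ I}
      let coset₂ : Set F := {α : F | α - η₂ ∈ I}
      let U : Set F := {x : F | x ∈ O ∧ (∃ y ∈ O, x * y = 1) ∧ x * σ x = 1 ∧
        (fun α => x * α) '' coset₁ = coset₁ ∧ (fun α => x * α) '' coset₂ = coset₂}
      let S : Set (F × F) := {p : F × F | p.1 ∈ coset₁ ∧ p.2 ∈ coset₂ ∧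
        p.1 * σ p.1 = algebraMap ℚ F t₁ ∧ p.2 * σ p.2 = algebraMap ℚ F t₂ ∧
        p.1 * σ p.2 + p.2 * σ p.1 = algebraMap ℚ F t₀}
      Finite (Quot (fun (p q : ↥S) =>
        ∃ x ∈ U, x * (p : F × F).1 = (q : F × F).1 ∧ x * (p : F × F).2 = (q : F × F).2)) ∧
      (Nat.card (Quot (fun (p q : ↥S) =>
        ∃ x ∈ U, x * (p : F × F).1 = (q : F × F).1 ∧
          x * (p : F × F).2 = (q : F × F).2)) : ℝ) ≤
        C * |((t₀ ^ 2 - 4 * t₁ * t₂ : ℚ) : ℝ)| ^ ε := by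
  intro ε hε
  classical
  obtain ⟨m, hm, hmint⟩ := exists_int_smul_isIntegral hOfg hIfg η₁ η₂
  obtain ⟨f, hf, hfO⟩ := exists_int_smul_mem_order hOspan hIne η₁ η₂
  obtain ⟨C, hC, hCle⟩ := Ideal.exists_card_dvd_le_absNorm_rpow (𝓞 F) hε
  have hfbot : Ideal.span {(f : 𝓞 F)} ≠ ⊥ := by
    rw [Ne, Ideal.span_singleton_eq_bot]
    exact_mod_cast hf
  have : Finite (𝓞 F ⧸ Ideal.span {(f : 𝓞 F)}) := Ideal.finiteQuotientOfFreeOfNeBot _ hfbot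
  set n : ℕ := Nat.card (𝓞 F ⧸ Ideal.span {(f : 𝓞 F)}) with hn
  have hnpos : 0 < n := Nat.card_pos
  have hm0 : (0 : ℝ) < (m : ℝ) ^ 4 := by positivity
  refine ⟨2 * (C * ((m : ℝ) ^ 4) ^ ε * n), by positivity, fun t₀ t₁ t₂ hD ↦ ?_⟩
  intro coset₁ coset₂ U S
  rcases isEmpty_or_nonempty S with hS | hS
  · refine ⟨inferInstance, ?_⟩
    rw [Nat.card_of_isEmpty, Nat.cast_zero]
    positivity
  let p₀ : S := Classical.choice hS
  have hmF : (m : F) ≠ 0 := by exact_mod_cast hm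
  have hDF : (algebraMap ℚ F t₀) ^ 2 - 4 * algebraMap ℚ F t₁ * algebraMap ℚ F t₂ ≠ 0 := by
    rw [show (algebraMap ℚ F t₀) ^ 2 - 4 * algebraMap ℚ F t₁ * algebraMap ℚ F t₂
      = algebraMap ℚ F (t₀ ^ 2 - 4 * t₁ * t₂) by simp]
    exact (map_ne_zero _).mpr hD
  have hsum : ∀ p : S, p.1.1 * σ p.1.2 + p.1.2 * σ p.1.1 = algebraMap ℚ F t₀ :=
    fun p ↦ p.2.2.2.2.2
  have hN₁ : ∀ p : S, p.1.1 * σ p.1.1 = algebraMap ℚ F t₁ := fun p ↦ p.2.2.2.1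
  have hN₂ : ∀ p : S, p.1.2 * σ p.1.2 = algebraMap ℚ F t₂ := fun p ↦ p.2.2.2.2.1
  have hne : ∀ p : S, p.1.1 ≠ 0 := fun p h ↦ hDF (by
    rw [← hsum p, ← hN₁ p, h]
    simp)
  have hdisc : ∀ p : S, (p.1.1 * σ p.1.2 - p.1.2 * σ p.1.1) ^ 2
      = algebraMap ℚ F t₀ ^ 2 - 4 * algebraMap ℚ F t₁ * algebraMap ℚ F t₂ := fun p ↦ by
    rw [← hsum p, ← hN₁ p, ← hN₂ p]
    ring
  -- The integral multiples of the coordinates and the ideal they generate.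
  let a : S → 𝓞 F := fun p ↦ ⟨m • p.1.1, hmint _ (Or.inl p.2.1)⟩
  let b : S → 𝓞 F := fun p ↦ ⟨m • p.1.2, hmint _ (Or.inr p.2.2.1)⟩
  have ha : ∀ p, (a p : F) = m * p.1.1 := fun p ↦ zsmul_eq_mul _ _
  have hb : ∀ p, (b p : F) = m * p.1.2 := fun p ↦ zsmul_eq_mul _ _
  have ha0 : ∀ p, a p ≠ 0 := fun p h ↦ mul_ne_zero hmF (hne p) (by rw [← ha, h]; simp)
  let τ : 𝓞 F → 𝓞 F := RingOfIntegers.mapAlgEquiv σ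
  have hτ : ∀ x : 𝓞 F, (τ x : F) = σ x := fun x ↦ rfl
  let δ : S → 𝓞 F := fun p ↦ a p * τ (b p) - b p * τ (a p)
  have hδ : ∀ p, (δ p : F) ^ 2 = algebraMap ℚ F (m ^ 4 * (t₀ ^ 2 - 4 * t₁ * t₂)) := fun p ↦ by
    have h₁ : (δ p : F) = m ^ 2 * (p.1.1 * σ p.1.2 - p.1.2 * σ p.1.1) := by
      simp only [δ, map_sub, map_mul, hτ, ha, hb, map_intCast]
      ring
    rw [h₁, mul_pow, hdisc]
    simp only [map_mul, map_sub, map_pow, map_intCast, map_ofNat]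
    ring
  let J : S → Ideal (𝓞 F) := fun p ↦ Ideal.span {a p, b p}
  have hδJ : ∀ p, δ p ∈ J p := fun p ↦ (J p).sub_mem
    ((J p).mul_mem_right _ (Ideal.subset_span (by simp)))
    ((J p).mul_mem_right _ (Ideal.subset_span (by simp)))
  have hJ : ∀ p, J p ∣ Ideal.span {δ p₀} := fun p ↦ by
    rw [Ideal.dvd_span_singleton]
    have hsq : δ p ^ 2 = δ p₀ ^ 2 := by
      apply FaithfulSMul.algebraMap_injective (𝓞 F) F
      rw [map_pow, map_pow, hδ, hδ]
    rcases sq_eq_sq_iff_eq_or_eq_neg.mp hsq with h | h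
    · exact h ▸ hδJ p
    · rw [← neg_eq_iff_eq_neg.mpr h]
      exact (J p).neg_mem (hδJ p)
  have hδnorm := absNorm_span_singleton_of_sq_eq hdeg (hδ p₀)
  have hδbot : Ideal.span {δ p₀} ≠ ⊥ := fun h ↦ by
    rw [h, Ideal.absNorm_bot, Nat.cast_zero, eq_comm, abs_eq_zero, Rat.cast_eq_zero] at hδnorm
    exact mul_ne_zero (by positivity) hD hδnorm
  obtain ⟨hfin, hcard⟩ := hCle _ hδbot
  -- Two pairs with the same invariants differ by a unit of norm one.
  let K : S → Bool × {A : Ideal (𝓞 F) // A ∣ Ideal.span {δ p₀}} := fun p ↦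
    (decide (p.1.1 * σ p.1.2 = p₀.1.1 * σ p₀.1.2), ⟨J p, hJ p⟩)
  have hKw : ∀ p q, K p = K q → p.1.1 * σ p.1.2 = q.1.1 * σ q.1.2 := fun p q h ↦ by
    have hroot : ∀ p : S, p.1.1 * σ p.1.2 = p₀.1.1 * σ p₀.1.2 ∨
        p.1.1 * σ p.1.2 = p₀.1.2 * σ p₀.1.1 := fun p ↦ by
      rw [← sub_eq_zero, ← sub_eq_zero (b := p₀.1.2 * σ p₀.1.1), ← mul_eq_zero]
      linear_combination p.1.1 * σ p.1.2 * (hsum p - hsum p₀)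
        - hN₁ p * (p.1.2 * σ p.1.2) - algebraMap ℚ F t₁ * hN₂ p
        + hN₁ p₀ * (p₀.1.2 * σ p₀.1.2) + algebraMap ℚ F t₁ * hN₂ p₀
    have h' := decide_eq_decide.mp (congrArg Prod.fst h)
    rcases hroot p with hp | hp
    · rw [hp, h'.mp hp]
    · rcases hroot q with hq | hq
      · rw [hq, h'.mpr hq]
      · rw [hp, hq]
  have hunit : ∀ p q, K p = K q → ∃ x y : 𝓞 F, (x : F) * y = 1 ∧ (x : F) * σ x = 1 ∧
      x * p.1.1 = q.1.1 ∧ x * p.1.2 = q.1.2 := fun p q h ↦ by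
    have hJeq : J p = J q := congrArg (fun k ↦ k.2.1) h
    obtain ⟨x, hxσ, hx₁, hx₂⟩ := exists_norm_one_ratio σ (hne p)
      ((hN₁ p).trans (hN₁ q).symm) (hKw p q h)
    have hx0 : x ≠ 0 := left_ne_zero_of_mul_eq_one hxσ
    have hxa : x * a p = a q := by rw [ha, ha, ← hx₁]; ring
    have hxb : x * b p = b q := by rw [hb, hb, ← hx₂]; ring
    have hintegral : IsIntegral ℤ x := isIntegral_of_span_pair_eq (ha0 p) hxa hxb hJeq.symm
    have hintegral' : IsIntegral ℤ x⁻¹ := isIntegral_of_span_pair_eq (ha0 q)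
      (by rw [← hxa, inv_mul_cancel_left₀ hx0]) (by rw [← hxb, inv_mul_cancel_left₀ hx0]) hJeq
    exact ⟨⟨x, hintegral⟩, ⟨x⁻¹, hintegral'⟩, mul_inv_cancel₀ hx0, hxσ, hx₁, hx₂⟩
  let r : S → S := fun p ↦ Function.invFun K (K p)
  have hr : ∀ p, K (r p) = K p := fun p ↦ Function.invFun_eq ⟨p, rfl⟩
  choose u v huv huσ hu₁ hu₂ using fun p ↦ hunit (r p) p (hr p)
  have hmemU : ∀ p q, (Ideal.Quotient.mk (Ideal.span {(f : 𝓞 F)}) (u p) =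
      Ideal.Quotient.mk (Ideal.span {(f : 𝓞 F)}) (u q)) → (u q : F) * v p ∈ U := by
    intro p q h
    obtain ⟨c, hc⟩ := Ideal.mem_span_singleton'.mp (Ideal.Quotient.eq.mp h.symm)
    have hcF : (c : F) * f = u q - u p := by
      simpa using congrArg (algebraMap (𝓞 F) F) hc
    have hz : (u q : F) * v p * (u p * v q) = 1 := by
      linear_combination huv p * (u q : F) * v q + huv q
    have hz₁ : (u q : F) * v p - 1 = f • ((c * v p : 𝓞 F) : F) := by
      rw [zsmul_eq_mul]
      change _ = (f : F) * ((c : F) * v p)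
      linear_combination -(v p : F) * hcF + huv p
    have hz₂ : (u p : F) * v q - 1 = f • ((-c * v q : 𝓞 F) : F) := by
      rw [zsmul_eq_mul]
      change _ = (f : F) * (-(c : F) * v q)
      linear_combination (v q : F) * hcF + huv q
    have hinv : ((u q : F) * v p)⁻¹ = u p * v q := inv_eq_of_mul_eq_one_right hz
    obtain ⟨hO₁, hη₁₁, hη₁₂⟩ := hfO _ (RingOfIntegers.isIntegral_coe (c * v p))
    obtain ⟨hO₂, hη₂₁, hη₂₂⟩ := hfO _ (RingOfIntegers.isIntegral_coe (-c * v q))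
    rw [← hz₁] at hO₁ hη₁₁ hη₁₂
    rw [← hz₂] at hO₂ hη₂₁ hη₂₂
    have hzO : (u q : F) * v p ∈ O := by simpa using O.add_mem hO₁ O.one_mem
    have hzO' : (u p : F) * v q ∈ O := by simpa using O.add_mem hO₂ O.one_mem
    have hσv : (v p : F) * σ (v p) = 1 := by
      have h₁ : σ (u p) * σ (v p) = 1 := by rw [← map_mul, huv, map_one]
      linear_combination huv p * σ (u p) * σ (v p) + h₁ - (v p : F) * σ (v p) * huσ p
    have hz0 : (u q : F) * v p ≠ 0 := left_ne_zero_of_mul_eq_one hz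
    refine ⟨hzO, ⟨_, hzO', hz⟩, ?_, ?_, ?_⟩
    · rw [map_mul]
      linear_combination huσ q * ((v p : F) * σ (v p)) + hσv
    · exact image_mul_coset_eq hz0 hzO (hinv ▸ hzO') hη₁₁ (hinv ▸ hη₂₁)
    · exact image_mul_coset_eq hz0 hzO (hinv ▸ hzO') hη₁₂ (hinv ▸ hη₂₂)
  let Φ : S → (Bool × {A : Ideal (𝓞 F) // A ∣ Ideal.span {δ p₀}}) ×
      (𝓞 F ⧸ Ideal.span {(f : 𝓞 F)}) := fun p ↦ (K p, Ideal.Quotient.mk _ (u p))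
  obtain ⟨hfinQ, hQ⟩ := card_quot_le_of_map (r := fun (p q : ↥S) =>
        ∃ x ∈ U, x * (p : F × F).1 = (q : F × F).1 ∧ x * (p : F × F).2 = (q : F × F).2) Φ
    (fun p q h ↦ by
      have hK : K p = K q := congrArg Prod.fst h
      have hrr : r p = r q := congrArg (Function.invFun K) hK
      refine ⟨_, hmemU p q (congrArg Prod.snd h), ?_, ?_⟩
      · rw [← hu₁ q, ← hu₁ p, hrr]
        linear_combination (u q : F) * (r q).1.1 * huv p
      · rw [← hu₂ q, ← hu₂ p, hrr]
        linear_combination (u q : F) * (r q).1.2 * huv p)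
  refine ⟨hfinQ, ?_⟩
  rw [Nat.card_prod, Nat.card_prod, Nat.card_eq_fintype_card (α := Bool), Fintype.card_bool,
    ← hn] at hQ
  rw [hδnorm, Rat.cast_mul, abs_mul, Rat.cast_pow, Rat.cast_intCast, abs_of_pos hm0,
    Real.mul_rpow hm0.le (abs_nonneg _)] at hcard
  calc _ ≤ (((2 * Nat.card {A : Ideal (𝓞 F) // A ∣ Ideal.span {δ p₀}}) * n : ℕ) : ℝ) := by
        exact_mod_cast hQ
    _ ≤ 2 * (C * (((m : ℝ) ^ 4) ^ ε * |((t₀ ^ 2 - 4 * t₁ * t₂ : ℚ) : ℝ)| ^ ε)) * n := by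
        push_cast at hcard ⊢
        gcongr
    _ = _ := by ring
end

section
/- Let n, r, m ∈ ℤ with gcd(n, r, m) = 1. Then {(σ₁, σ₂, s) ∈ ℤ³ : m·σ₁ = n·σ₂, n·s = r·σ₁, and r·σ₂ = m·s} = ℤ·(n, m, r), i.e. the solution set consists exactly of the integer multiples of (n, m, r). -/
/-- For coprime `n, r, m`, the solutions of `mσ₁ = nσ₂`, `ns = rσ₁`, `rσ₂ = ms` in `ℤ³`
are exactly the integer multiples of `(n, m, r)`. -/
theorem stmt10 (n r m : ℤ) (h : Int.gcd n (Int.gcd r m) = 1) :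
    {p : ℤ × ℤ × ℤ | m * p.1 = n * p.2.1 ∧ n * p.2.2 = r * p.1 ∧ r * p.2.1 = m * p.2.2} =
      {p : ℤ × ℤ × ℤ | ∃ k : ℤ, p = (k * n, k * m, k * r)} := by
  obtain ⟨a, b, c, e⟩ : ∃ a b c : ℤ, n * a + r * b + m * c = 1 := by
    have h₁ := Int.gcd_eq_gcd_ab n (Int.gcd r m)
    have h₂ := Int.gcd_eq_gcd_ab r m
    rw [h, Nat.cast_one] at h₁
    set u := Int.gcdB n (Int.gcd r m)
    exact ⟨Int.gcdA n (Int.gcd r m), Int.gcdA r m * u, Int.gcdB r m * u, by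
      linear_combination -h₁ - u * h₂⟩
  ext ⟨x, y, z⟩
  simp only [Set.mem_ofPred_eq, Prod.mk.injEq]
  constructor
  · rintro ⟨h₁, h₂, h₃⟩
    refine ⟨a * x + b * z + c * y, ?_, ?_, ?_⟩
    · linear_combination -x * e - b * h₂ + c * h₁
    · linear_combination -y * e - a * h₁ + b * h₃
    · linear_combination -z * e + a * h₂ - c * h₃
  · rintro ⟨k, rfl, rfl, rfl⟩
    exact ⟨by ring, by ring, by ring⟩
end

section
/- Let n, r, m ∈ ℤ with gcd(n, r, m) = 1 and D := r² − 4nm ≠ 0. Fix t, d ∈ ℤ and set 𝒮 = {(σ₁, σ₂, s) ∈ ℤ³ : 2m·σ₁ + 2n·σ₂ − r·s = t and s² − 4σ₁σ₂ = d}. Then: (a) if 𝒮 is nonempty, then t² ≡ D·d (mod 4); and (b) the map (σ₁, σ₂, s) ↦ (m·σ₁ − n·σ₂, n·s − r·σ₁, r·σ₂ − m·s) is an injection from 𝒮 into {(u, v, w) ∈ ℤ³ : r·u + m·v + n·w = 0 and 4(u² − v·w) = t² − D·d}. -/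
/-- The counting lemma `𝒩_T(t,d) ≤ r_T((t² − Dd)/4)` in integer coordinates:
(a) if the set `𝒮` is nonempty then `t² ≡ Dd (mod 4)`; (b) the indicated linear map
injects `𝒮` into the set of `(u,v,w)` with `ru + mv + nw = 0` and
`4(u² − vw) = t² − Dd`. -/
theorem stmt11 (n r m t d : ℤ) (hg : Int.gcd n (Int.gcd r m) = 1)
    (D : ℤ) (hD : D = r ^ 2 - 4 * n * m) (hD0 : D ≠ 0) :
    (({p : ℤ × ℤ × ℤ |
        2 * m * p.1 + 2 * n * p.2.1 - r * p.2.2 = t ∧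
        p.2.2 ^ 2 - 4 * p.1 * p.2.1 = d} : Set (ℤ × ℤ × ℤ)).Nonempty →
      t ^ 2 ≡ D * d [ZMOD 4]) ∧
    Set.InjOn
      (fun p : ℤ × ℤ × ℤ =>
        ((m * p.1 - n * p.2.1, n * p.2.2 - r * p.1, r * p.2.1 - m * p.2.2) : ℤ × ℤ × ℤ))
      {p : ℤ × ℤ × ℤ |
        2 * m * p.1 + 2 * n * p.2.1 - r * p.2.2 = t ∧
        p.2.2 ^ 2 - 4 * p.1 * p.2.1 = d} ∧
    Set.MapsTo
      (fun p : ℤ × ℤ × ℤ =>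
        ((m * p.1 - n * p.2.1, n * p.2.2 - r * p.1, r * p.2.1 - m * p.2.2) : ℤ × ℤ × ℤ))
      {p : ℤ × ℤ × ℤ |
        2 * m * p.1 + 2 * n * p.2.1 - r * p.2.2 = t ∧
        p.2.2 ^ 2 - 4 * p.1 * p.2.1 = d}
      {q : ℤ × ℤ × ℤ |
        r * q.1 + m * q.2.1 + n * q.2.2 = 0 ∧
        4 * (q.1 ^ 2 - q.2.1 * q.2.2) = t ^ 2 - D * d} := by
  refine ⟨?_, ?_, ?_⟩
  · rintro ⟨⟨a, b, s⟩, ht, hd⟩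
    simp only at ht hd
    subst ht hd hD
    rw [Int.modEq_iff_dvd]
    refine ⟨-((m * a - n * b) ^ 2 - (n * s - r * a) * (r * b - m * s)), ?_⟩
    ring
  · rintro ⟨a, b, s⟩ ⟨ht, -⟩ ⟨a', b', s'⟩ ⟨ht', -⟩ h
    simp only [Prod.mk.injEq] at ht ht' h ⊢
    obtain ⟨hu, hv, hw⟩ := h
    have hL := ht.trans ht'.symm
    refine ⟨mul_left_cancel₀ hD0 ?_, mul_left_cancel₀ hD0 ?_, mul_left_cancel₀ hD0 ?_⟩ <;>
      subst hD
    · linear_combination -r * hv - n * hL - 2 * n * hu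
    · linear_combination r * hw - m * hL + 2 * m * hu
    · linear_combination -r * hL - 2 * m * hv + 2 * n * hw
  · rintro ⟨a, b, s⟩ ⟨ht, hd⟩
    simp only at ht hd
    subst ht hd hD
    constructor <;> ring
end

section
/- Let a, b, c ∈ ℤ with gcd(a, b, c) = 1. Then the subgroup {(x, y, z) ∈ ℤ³ : b·x + a·y − c·z = 0} of ℤ³ is generated by the three vectors (a, −b, 0), (0, c, a), and (−c, 0, −b). -/
/-- For a primitive triple `(a,b,c)`, the subgroup `{(x,y,z) ∈ ℤ³ : bx + ay − cz = 0}`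
is generated by `(a,−b,0)`, `(0,c,a)` and `(−c,0,−b)`. -/
theorem stmt13 (a b c : ℤ) (h : Int.gcd a (Int.gcd b c) = 1) :
    {p : ℤ × ℤ × ℤ | b * p.1 + a * p.2.1 - c * p.2.2 = 0} =
      (Submodule.span ℤ
        ({((a, -b, 0) : ℤ × ℤ × ℤ), ((0, c, a) : ℤ × ℤ × ℤ),
          ((-c, 0, -b) : ℤ × ℤ × ℤ)} : Set (ℤ × ℤ × ℤ)) : Set (ℤ × ℤ × ℤ)) := by
  obtain ⟨r, s, t, hb⟩ : ∃ r s t : ℤ, a * r + b * s + c * t = 1 := by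
    have h₁ := Int.gcd_eq_gcd_ab a (Int.gcd b c)
    have h₂ := Int.gcd_eq_gcd_ab b c
    rw [h, Nat.cast_one] at h₁
    refine ⟨Int.gcdA a (Int.gcd b c), Int.gcdA b c * Int.gcdB a (Int.gcd b c),
      Int.gcdB b c * Int.gcdB a (Int.gcd b c), ?_⟩
    linear_combination -h₁ - Int.gcdB a (Int.gcd b c) * h₂
  ext ⟨x, y, z⟩
  simp only [Set.mem_ofPred_eq, SetLike.mem_coe, Submodule.mem_span_triple]
  constructor
  · intro hp
    refine ⟨r * x - s * y, r * z + t * y, -(s * z + t * x), ?_⟩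
    simp only [Prod.smul_mk, Prod.mk_add_mk, smul_eq_mul, Prod.mk.injEq]
    refine ⟨?_, ?_, ?_⟩
    · linear_combination x * hb - s * hp
    · linear_combination y * hb - r * hp
    · linear_combination z * hb + t * hp
  · rintro ⟨α, β, γ, hp⟩
    simp only [Prod.smul_mk, Prod.mk_add_mk, smul_eq_mul, Prod.mk.injEq] at hp
    obtain ⟨rfl, rfl, rfl⟩ := hp
    ring
end

section
/- Let a, b, c ∈ ℤ with gcd(a, b, c) = 1 and d := b² − 4ac ≠ 0. Let L_q = {(x, y, z) ∈ ℤ³ : b·x + a·y − c·z = 0} and v_q = (b, −2c, 2a). Then: (i) Q(v_q) = d, where Q(x, y, z) = x² + y·z; (ii) the group homomorphism ℤ³ → ℤ/dℤ sending (x, y, z) to the class of b·x + a·y − c·z is surjective with kernel equal to L_q + ℤ·v_q; consequently the subgroup L_q + ℤ·v_q has index |d| in ℤ³. -/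
/-- `L_q + ℤ·v_q`, where `L_q = {(x,y,z) : bx + ay − cz = 0}` and `v_q = (b,−2c,2a)`. -/
def lqPlus (a b c : ℤ) : Submodule ℤ (ℤ × ℤ × ℤ) :=
  Submodule.span ℤ
    ({p : ℤ × ℤ × ℤ | b * p.1 + a * p.2.1 - c * p.2.2 = 0} ∪
      {((b, -2 * c, 2 * a) : ℤ × ℤ × ℤ)})

/-- The linear form `(x,y,z) ↦ bx + ay − cz` on `ℤ³`. -/
def lqForm (a b c : ℤ) : (ℤ × ℤ × ℤ) →+ ℤ where
  toFun p := b * p.1 + a * p.2.1 - c * p.2.2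
  map_zero' := by simp
  map_add' p r := by
    simp only [Prod.fst_add, Prod.snd_add]
    ring

theorem lqForm_apply (a b c : ℤ) (p : ℤ × ℤ × ℤ) :
    lqForm a b c p = b * p.1 + a * p.2.1 - c * p.2.2 := rfl

/-- Bézout: the linear form attached to a primitive triple takes every integer value. -/
theorem lqForm_surjective {a b c : ℤ} (h : Int.gcd a (Int.gcd b c) = 1) :
    Function.Surjective (lqForm a b c) := by
  intro n
  have h₁ := Int.gcd_eq_gcd_ab a (Int.gcd b c)
  have h₂ := Int.gcd_eq_gcd_ab b c
  rw [h, Nat.cast_one] at h₁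
  set u := Int.gcdA a (Int.gcd b c)
  set v := Int.gcdB a (Int.gcd b c)
  refine ⟨(n * (Int.gcdA b c * v), n * u, -(n * (Int.gcdB b c * v))), ?_⟩
  rw [lqForm_apply]
  linear_combination (-n) * h₁ - n * v * h₂

/-- `L_q + ℤ·v_q` consists of the points where the linear form is divisible by `d`. -/
theorem mem_lqPlus_iff {a b c : ℤ} (p : ℤ × ℤ × ℤ) :
    p ∈ lqPlus a b c ↔ b ^ 2 - 4 * a * c ∣ lqForm a b c p := by
  constructor
  · intro hp
    induction hp using Submodule.span_induction with
    | mem x hx =>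
      rcases hx with hx | rfl
      · exact (show lqForm a b c x = 0 from hx) ▸ dvd_zero _
      · refine ⟨1, ?_⟩
        rw [lqForm_apply]
        ring
    | zero => simp
    | add x y _ _ hx hy => simpa only [map_add] using dvd_add hx hy
    | smul n x _ hx => simpa only [map_zsmul, smul_eq_mul] using hx.mul_left n
  · rintro ⟨k, hk⟩
    have hv : ((b, -2 * c, 2 * a) : ℤ × ℤ × ℤ) ∈ lqPlus a b c :=
      Submodule.subset_span (Or.inr rfl)
    have hL : p - k • ((b, -2 * c, 2 * a) : ℤ × ℤ × ℤ) ∈ lqPlus a b c := by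
      refine Submodule.subset_span (Or.inl ?_)
      change lqForm a b c _ = 0
      rw [map_sub, map_zsmul, hk, lqForm_apply, smul_eq_mul]
      ring
    simpa using add_mem hL ((lqPlus a b c).smul_mem k hv)

/-- For a primitive triple `(a,b,c)` of discriminant `d = b² − 4ac ≠ 0`:
(i) `Q(v_q) = d` for `Q(x,y,z) = x² + yz` and `v_q = (b,−2c,2a)`;
(ii) the map `ℤ³ → ℤ/dℤ`, `(x,y,z) ↦ bx + ay − cz`, is surjective with kernel
`L_q + ℤ·v_q`, which therefore has index `|d|` in `ℤ³`. -/
theorem stmt14 (a b c : ℤ) (h : Int.gcd a (Int.gcd b c) = 1)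
    (d : ℤ) (hd : d = b ^ 2 - 4 * a * c) (hd0 : d ≠ 0) :
    (b ^ 2 + (-2 * c) * (2 * a) = d) ∧
    Function.Surjective
      (fun p : ℤ × ℤ × ℤ =>
        ((b * p.1 + a * p.2.1 - c * p.2.2 : ℤ) : ZMod d.natAbs)) ∧
    {p : ℤ × ℤ × ℤ |
        ((b * p.1 + a * p.2.1 - c * p.2.2 : ℤ) : ZMod d.natAbs) = 0} =
      (lqPlus a b c : Set (ℤ × ℤ × ℤ)) ∧
    (lqPlus a b c).toAddSubgroup.index = d.natAbs := by
  subst hd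
  set d := b ^ 2 - 4 * a * c with hd
  let f : (ℤ × ℤ × ℤ) →+ ZMod d.natAbs := (Int.castAddHom _).comp (lqForm a b c)
  have hf : Function.Surjective f := (ZMod.intCast_surjective).comp (lqForm_surjective h)
  have hker (p : ℤ × ℤ × ℤ) : f p = 0 ↔ p ∈ lqPlus a b c := by
    rw [mem_lqPlus_iff, ← hd, ← Int.natAbs_dvd]
    exact ZMod.intCast_zmod_eq_zero_iff_dvd _ _
  refine ⟨by rw [hd]; ring, hf, Set.ext hker, ?_⟩
  have hK : (lqPlus a b c).toAddSubgroup = f.ker := by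
    ext p
    exact (hker p).symm
  rw [hK, AddSubgroup.index_ker, AddMonoidHom.range_eq_top.mpr hf, AddSubgroup.card_top,
    Nat.card_zmod]
end

section
/- Identify a triple (x, y, z) ∈ ℝ³ with the trace-zero 2×2 real matrix M = ((−x, y),(z, x)), and to a pair X = (X₁, X₂) of such matrices associate the binary quadratic form q_X(s,t) = a·s² + b·st + c·t² with a = x₁z₂ − x₂z₁, b = z₁y₂ − z₂y₁, c = x₁y₂ − x₂y₁. Then: (i) for every g ∈ SL₂(ℝ), writing X'ᵢ = g⁻¹·Mᵢ·g (again trace-zero), one has q_{X'}(s, t) = q_X(g·(s,t)) for all (s,t) ∈ ℝ², where g·(s,t) is the usual matrix-vector product; and (ii) for every h ∈ GL₂(ℝ), writing X·h = (h₁₁X₁ + h₂₁X₂, h₁₂X₁ + h₂₂X₂), one has q_{X·h} = det(h)·q_X. -/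
/-- The binary quadratic form `q_X(s,t) = a s² + b st + c t²` associated to a pair of
trace-zero 2×2 matrices, where for `Mᵢ = ((−xᵢ, yᵢ),(zᵢ, xᵢ))` one has
`a = x₁z₂ − x₂z₁`, `b = z₁y₂ − z₂y₁`, `c = x₁y₂ − x₂y₁`
(so `xᵢ = Mᵢ 1 1`, `yᵢ = Mᵢ 0 1`, `zᵢ = Mᵢ 1 0`). -/
def qX (M₁ M₂ : Matrix (Fin 2) (Fin 2) ℝ) (s t : ℝ) : ℝ :=
  (M₁ 1 1 * M₂ 1 0 - M₂ 1 1 * M₁ 1 0) * s ^ 2 +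
  (M₁ 1 0 * M₂ 0 1 - M₂ 1 0 * M₁ 0 1) * s * t +
  (M₁ 1 1 * M₂ 0 1 - M₂ 1 1 * M₁ 0 1) * t ^ 2

/-- (i) `SL₂(ℝ)`-equivariance `q_{g⁻¹Xg}(v) = q_X(g·v)` and (ii) `GL₂(ℝ)`-covariance
`q_{X·h} = det(h)·q_X` of the map from pairs of trace-zero matrices to binary
quadratic forms. -/
theorem stmt17 (M₁ M₂ : Matrix (Fin 2) (Fin 2) ℝ)
    (h₁ : Matrix.trace M₁ = 0) (h₂ : Matrix.trace M₂ = 0) :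
    (∀ g : Matrix (Fin 2) (Fin 2) ℝ, g.det = 1 → ∀ s t : ℝ,
      qX (g⁻¹ * M₁ * g) (g⁻¹ * M₂ * g) s t =
        qX M₁ M₂ (g 0 0 * s + g 0 1 * t) (g 1 0 * s + g 1 1 * t)) ∧
    (∀ h : Matrix (Fin 2) (Fin 2) ℝ, h.det ≠ 0 → ∀ s t : ℝ,
      qX (h 0 0 • M₁ + h 1 0 • M₂) (h 0 1 • M₁ + h 1 1 • M₂) s t =
        h.det * qX M₁ M₂ s t) := by
  rw [Matrix.trace_fin_two] at h₁ h₂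
  have e₁ : M₁ 0 0 = -M₁ 1 1 := by linarith
  have e₂ : M₂ 0 0 = -M₂ 1 1 := by linarith
  refine ⟨fun g hg s t => ?_, fun h _ s t => ?_⟩
  · have hinv : g⁻¹ = g.adjugate := by simp [Matrix.inv_def, hg]
    rw [Matrix.det_fin_two] at hg
    simp only [qX, hinv, Matrix.adjugate_fin_two, Matrix.mul_apply, Fin.sum_univ_two,
      Matrix.of_apply, Matrix.cons_val', Matrix.cons_val_zero, Matrix.cons_val_one,
      Matrix.cons_val_fin_one, e₁, e₂]
    linear_combination
      ((M₁ 1 1 * M₂ 1 0 - M₂ 1 1 * M₁ 1 0) * (g 0 0 * s + g 0 1 * t) ^ 2 +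
        (M₁ 1 0 * M₂ 0 1 - M₂ 1 0 * M₁ 0 1) * (g 0 0 * s + g 0 1 * t) *
          (g 1 0 * s + g 1 1 * t) +
        (M₁ 1 1 * M₂ 0 1 - M₂ 1 1 * M₁ 0 1) * (g 1 0 * s + g 1 1 * t) ^ 2) * hg
  · simp only [qX, Matrix.det_fin_two, Matrix.add_apply, Matrix.smul_apply, smul_eq_mul]
    ring
end
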